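/- arXiv:1705.02978 — 4 statements merged into one kernel-verified Lean document; each statement's English description precedes it below -/
import Mathlib

section
/- Let q_1, …, q_n be unit vectors in ℝ^d and t ≥ 1. If the homogeneous polynomials x ↦ (q_j · x)^{t−1}, j = 1, …, n, are linearly independent in Hom_{t−1}(ℝ^d), then the polynomials x ↦ (q_j · x)^t, j = 1, …, n, are linearly independent in Hom_t(ℝ^d). -/
open MvPolynomial

/-- Let `q 1, …, q n` be unit vectors in `ℝ^d` and `t ≥ 1`. If the
homogeneous polynomials `x ↦ (q j ⬝ x)^(t-1)` are linearly independent in `Hom_{t-1}(ℝ^d)`,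
then the polynomials `x ↦ (q j ⬝ x)^t` are linearly independent in `Hom_t(ℝ^d)`. -/
theorem linearIndependent_of_power_linearIndependent (d n t : ℕ) (ht : 1 ≤ t)
    (q : Fin n → Fin d → ℝ) (hq : ∀ j, ∑ i, (q j i) ^ 2 = 1)
    (hind : LinearIndependent ℝ
      (fun j : Fin n => (∑ i, MvPolynomial.C (q j i) * MvPolynomial.X i) ^ (t - 1))) :
    LinearIndependent ℝ
      (fun j : Fin n => (∑ i, MvPolynomial.C (q j i) * MvPolynomial.X i) ^ t) := by
  rw [Fintype.linearIndependent_iff] at hind ⊢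
  intro c hc j
  have ht0 : (t : ℝ) ≠ 0 := by
    have : t ≠ 0 := by omega
    exact_mod_cast this
  have key : ∀ k, c j * q j k = 0 := by
    intro k
    have hL : ∀ l, pderiv k (∑ i, MvPolynomial.C (q l i) * MvPolynomial.X i :
        MvPolynomial (Fin d) ℝ) = C (q l k) := by
      intro l
      rw [map_sum, Finset.sum_eq_single k]
      · rw [pderiv_C_mul, pderiv_X_self, mul_one]
      · intro b _ hb
        rw [pderiv_C_mul, pderiv_X_of_ne hb, mul_zero]
      · simp
    have h1 := congrArg (pderiv k) hc
    rw [map_sum, map_zero] at h1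
    have h2 := hind (fun l => t * (c l * q l k)) (by
      rw [← h1]
      refine Finset.sum_congr rfl fun l _ => ?_
      rw [Derivation.map_smul, pderiv_pow, hL, smul_eq_C_mul, smul_eq_C_mul]
      simp only [map_mul, map_natCast]
      ring) j
    exact (mul_eq_zero.mp h2).resolve_left ht0
  calc c j = c j * ∑ i, (q j i) ^ 2 := by rw [hq, mul_one]
    _ = ∑ i, (c j * q j i) * q j i := by
      rw [Finset.mul_sum]
      exact Finset.sum_congr rfl fun i _ => by ring
    _ = 0 := by simp [key]
end

section
/- Let 1 ≤ k ≤ d−1, t ∈ ℕ, and let σ_{k,d} be an O(d)-invariant Borel probability measure on G_{k,d}. If points P_1, …, P_n ∈ G_{k,d} and real weights ω_1, …, ω_n satisfy Σ_{j=1}^n ω_j = 1 and Σ_{i=1}^n Σ_{j=1}^n ω_i ω_j tr(P_i P_j)^t = ∫_{G_{k,d}} ∫_{G_{k,d}} tr(P R)^t dσ_{k,d}(P) dσ_{k,d}(R), then {(P_j, ω_j)}_{j=1}^n is a cubature for Hom_t(G_{k,d}). -/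
open Matrix MeasureTheory MvPolynomial

noncomputable instance (d : ℕ) : MeasurableSpace (Matrix (Fin d) (Fin d) ℝ) :=
  inferInstanceAs (MeasurableSpace (Fin d → Fin d → ℝ))

/-- The Grassmannian `G_{k,d}` of rank-`k` orthogonal projectors in `ℝ^{d×d}`. -/
def Grass (d k : ℕ) : Set (Matrix (Fin d) (Fin d) ℝ) :=
  {P | P.IsSymm ∧ P * P = P ∧ P.trace = k}

lemma conj_mem_Grass {d k : ℕ} {U : Matrix (Fin d) (Fin d) ℝ}
    (hU : U ∈ Matrix.orthogonalGroup (Fin d) ℝ) {P : Matrix (Fin d) (Fin d) ℝ}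
    (hP : P ∈ Grass d k) : U * P * Uᵀ ∈ Grass d k := by
  obtain ⟨hs, hi, ht⟩ := hP
  have hU2 : Uᵀ * U = 1 := by
    have := (Matrix.mem_orthogonalGroup_iff' (Fin d) ℝ).mp hU
    simpa using this
  refine ⟨?_, ?_, ?_⟩
  · unfold Matrix.IsSymm
    simp [Matrix.transpose_mul, hs.eq, Matrix.mul_assoc]
  · calc U * P * Uᵀ * (U * P * Uᵀ) = U * P * (Uᵀ * U) * P * Uᵀ := by
          simp [Matrix.mul_assoc]
    _ = U * (P * P) * Uᵀ := by simp [hU2, Matrix.mul_assoc]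
    _ = U * P * Uᵀ := by rw [hi]
  · rw [Matrix.trace_mul_cycle, hU2, Matrix.one_mul, ht]

/-- The conjugation action `P ↦ U P Uᵀ` of an orthogonal matrix `U` on the Grassmannian. -/
def conjGrass {d k : ℕ} {U : Matrix (Fin d) (Fin d) ℝ}
    (hU : U ∈ Matrix.orthogonalGroup (Fin d) ℝ) (P : Grass d k) : Grass d k :=
  ⟨U * P.val * Uᵀ, conj_mem_Grass hU P.property⟩

/-- `σ` is an `O(d)`-invariant measure on the Grassmannian `G_{k,d}`. -/
def IsOrthInvariant {d k : ℕ} (σ : Measure (Grass d k)) : Prop :=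
  ∀ U : Matrix (Fin d) (Fin d) ℝ, ∀ hU : U ∈ Matrix.orthogonalGroup (Fin d) ℝ,
    Measure.map (conjGrass hU) σ = σ

/-- `{(P j, ω j)}` is a cubature for `Hom_t(G_{k,d})` with respect to `σ`:
for every homogeneous polynomial `p` of degree `t` in the matrix entries, the integral of `p`
over the Grassmannian equals the weighted sum of point evaluations. -/
def IsCubature {d k : ℕ} (σ : Measure (Grass d k)) {n : ℕ}
    (P : Fin n → Grass d k) (ω : Fin n → ℝ) (t : ℕ) : Prop :=
  ∀ p ∈ MvPolynomial.homogeneousSubmodule (Fin d × Fin d) ℝ t,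
    ∫ Q : Grass d k, MvPolynomial.eval (fun ij => (Q : Matrix (Fin d) (Fin d) ℝ) ij.1 ij.2) p ∂σ =
      ∑ j, ω j * MvPolynomial.eval (fun ij => (P j : Matrix (Fin d) (Fin d) ℝ) ij.1 ij.2) p

/-- Idempotent symmetric real matrices of the same trace have the same characteristic polynomial. -/
lemma grass_charpoly {d k : ℕ} {P : Matrix (Fin d) (Fin d) ℝ} (hP : P ∈ Grass d k) :
    P.charpoly = (Polynomial.X - 1) ^ k * Polynomial.X ^ (d - k) := by
  obtain ⟨hs, hi, ht⟩ := hP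
  have hH : P.IsHermitian := by
    rw [Matrix.IsHermitian, Matrix.conjTranspose_eq_transpose_of_trivial]; exact hs
  have hev : ∀ i, hH.eigenvalues i = 0 ∨ hH.eigenvalues i = 1 := by
    intro i
    have h1 := hH.mulVec_eigenvectorBasis i
    have h2 : P *ᵥ (P *ᵥ ⇑(hH.eigenvectorBasis i)) = P *ᵥ ⇑(hH.eigenvectorBasis i) := by
      rw [Matrix.mulVec_mulVec, hi]
    rw [h1, Matrix.mulVec_smul, h1, smul_smul] at h2
    have hne : (⇑(hH.eigenvectorBasis i) : Fin d → ℝ) ≠ 0 := by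
      intro h
      apply hH.eigenvectorBasis.orthonormal.ne_zero i
      ext j
      exact congrFun h j
    have h3 := smul_left_injective ℝ hne h2
    have : hH.eigenvalues i * (hH.eigenvalues i - 1) = 0 := by linarith
    rcases mul_eq_zero.mp this with h | h
    · exact Or.inl h
    · exact Or.inr (by linarith)
  have htr := hH.trace_eq_sum_eigenvalues
  have hsum : ∑ i, hH.eigenvalues i = ((Finset.univ.filter fun i => hH.eigenvalues i = 1).card : ℝ) := by
    rw [Finset.card_filter]
    push_cast
    refine Finset.sum_congr rfl fun i _ => ?_
    rcases hev i with h | h <;> simp [h]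
  have hcard : (Finset.univ.filter fun i => hH.eigenvalues i = 1).card = k := by
    have : ((Finset.univ.filter fun i => hH.eigenvalues i = 1).card : ℝ) = k := by
      rw [← hsum, ← ht, htr]; simp
    exact_mod_cast this
  have hcard2 : (Finset.univ.filter fun i => ¬ hH.eigenvalues i = 1).card = d - k := by
    have := Finset.card_filter_add_card_filter_not (s := (Finset.univ : Finset (Fin d)))
      (fun i => hH.eigenvalues i = 1)
    simp only [Finset.card_univ, Fintype.card_fin] at this
    omega
  rw [hH.charpoly_eq]
  have : ∀ i, (Polynomial.X - Polynomial.C ((hH.eigenvalues i : ℝ)) : Polynomial ℝ) =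
      if hH.eigenvalues i = 1 then Polynomial.X - 1 else Polynomial.X := by
    intro i
    rcases hev i with h | h <;> simp [h]
  calc _ = ∏ i, (if hH.eigenvalues i = 1 then Polynomial.X - 1 else Polynomial.X : Polynomial ℝ) :=
        Finset.prod_congr rfl fun i _ => this i
    _ = _ := by rw [Finset.prod_ite, Finset.prod_const, Finset.prod_const, hcard, hcard2]

/-- The orthogonal group acts transitively on the Grassmannian. -/
lemma grass_transitive {d k : ℕ} (P R : Grass d k) :
    ∃ U : Matrix (Fin d) (Fin d) ℝ, ∃ hU : U ∈ Matrix.orthogonalGroup (Fin d) ℝ,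
      conjGrass hU P = R := by
  have hH : ∀ Q : Grass d k, Q.val.IsHermitian := fun Q => by
    rw [Matrix.IsHermitian, Matrix.conjTranspose_eq_transpose_of_trivial]; exact Q.2.1
  have he : (hH P).eigenvalues = (hH R).eigenvalues := by
    rw [Matrix.IsHermitian.eigenvalues_eq_eigenvalues_iff, grass_charpoly P.2, grass_charpoly R.2]
  have h1 := (hH P).spectral_theorem
  have h2 := (hH R).spectral_theorem
  rw [← he] at h2
  set A := (hH P).eigenvectorUnitary
  set B := (hH R).eigenvectorUnitary
  set D := diagonal ((RCLike.ofReal : ℝ → ℝ) ∘ (hH P).eigenvalues)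
  have h3 := (B * star A).2
  refine ⟨((B * star A : unitary _) : Matrix (Fin d) (Fin d) ℝ), h3, Subtype.ext ?_⟩
  have hAA : star (A : Matrix (Fin d) (Fin d) ℝ) * (A : Matrix (Fin d) (Fin d) ℝ) = 1 :=
    Unitary.coe_star_mul_self A
  have hT : ∀ M : Matrix (Fin d) (Fin d) ℝ, Mᵀ = star M := fun M => by
    rw [Matrix.star_eq_conjTranspose, Matrix.conjTranspose_eq_transpose_of_trivial]
  simp only [Unitary.conjStarAlgAut_apply] at h1 h2
  change ((B * star A : unitary _) : Matrix (Fin d) (Fin d) ℝ) * P.val *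
    ((B * star A : unitary _) : Matrix (Fin d) (Fin d) ℝ)ᵀ = R.val
  rw [hT, h2, h1]
  simp only [Submonoid.coe_mul, Unitary.coe_star, star_mul, star_star]
  calc (B : Matrix (Fin d) (Fin d) ℝ) * star (A : Matrix (Fin d) (Fin d) ℝ) *
        (A * D * star (A : Matrix (Fin d) (Fin d) ℝ)) * (A * star (B : Matrix (Fin d) (Fin d) ℝ))
      = B * (star (A : Matrix (Fin d) (Fin d) ℝ) * A) * D *
        (star (A : Matrix (Fin d) (Fin d) ℝ) * A) * star (B : Matrix (Fin d) (Fin d) ℝ) := by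
        simp only [Matrix.mul_assoc]
    _ = _ := by rw [hAA]; simp

lemma grass_abs_le {d k : ℕ} (P : Grass d k) (i j : Fin d) : |P.val i j| ≤ 1 := by
  obtain ⟨hs, hi, -⟩ := P.2
  have key : ∀ i j, P.val i j ^ 2 ≤ P.val i i := by
    intro i j
    have h := congrFun (congrFun hi i) i
    rw [Matrix.mul_apply] at h
    rw [← h]
    have : P.val i j ^ 2 = P.val i j * P.val j i := by rw [hs.apply i j]; ring
    rw [this]
    refine Finset.single_le_sum (f := fun l => P.val i l * P.val l i) (fun l _ => ?_)
      (Finset.mem_univ j)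
    change 0 ≤ P.val i l * P.val l i
    rw [hs.apply i l]
    exact mul_self_nonneg _
  have h1 := key i i
  have h2 := key i j
  rw [abs_le_one_iff_mul_self_le_one]
  nlinarith [sq_nonneg (P.val i i - 1)]

/-- Coordinates of the `t`-fold tensor power. -/
def tens {d : ℕ} (t : ℕ) (Q : Matrix (Fin d) (Fin d) ℝ) (m : Fin t → Fin d × Fin d) : ℝ :=
  ∏ s, Q (m s).1 (m s).2

lemma measurable_entry {d k : ℕ} (i j : Fin d) : Measurable fun Q : Grass d k => Q.val i j := by
  have h : Measurable fun M : Matrix (Fin d) (Fin d) ℝ => M i j :=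
    (measurable_pi_apply j).comp (measurable_pi_apply (X := fun _ : Fin d => Fin d → ℝ) i)
  exact h.comp measurable_subtype_coe

lemma integrable_tens {d k t : ℕ} (σ : Measure (Grass d k)) [IsProbabilityMeasure σ]
    (m : Fin t → Fin d × Fin d) : Integrable (fun Q : Grass d k => tens t Q.val m) σ := by
  refine Integrable.of_bound (C := 1) ?_ (Filter.Eventually.of_forall fun Q => ?_)
  · refine Measurable.aestronglyMeasurable ?_
    unfold tens
    exact Finset.measurable_prod _ fun s _ => measurable_entry _ _
  · rw [tens, Real.norm_eq_abs, Finset.abs_prod]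
    exact Finset.prod_le_one (fun _ _ => abs_nonneg _) fun _ _ => grass_abs_le _ _ _

lemma trace_pow_eq {d k t : ℕ} (Q R : Grass d k) :
    (Matrix.trace (Q.val * R.val)) ^ t = ∑ m, tens t Q.val m * tens t R.val m := by
  have : Matrix.trace (Q.val * R.val) = ∑ ij : Fin d × Fin d, Q.val ij.1 ij.2 * R.val ij.1 ij.2 := by
    rw [Fintype.sum_prod_type, Matrix.trace]
    refine Finset.sum_congr rfl fun i _ => ?_
    rw [Matrix.diag_apply, Matrix.mul_apply]
    refine Finset.sum_congr rfl fun j _ => ?_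
    rw [R.2.1.apply i j]
  rw [this, Fintype.sum_pow]
  simp only [tens, Finset.prod_mul_distrib]

lemma measurable_conjGrass {d k : ℕ} {U : Matrix (Fin d) (Fin d) ℝ}
    (hU : U ∈ Matrix.orthogonalGroup (Fin d) ℝ) :
    Measurable (conjGrass (k := k) hU) := by
  refine Measurable.subtype_mk ?_
  refine measurable_pi_lambda _ fun i => measurable_pi_lambda _ fun j => ?_
  simp only [Matrix.mul_apply]
  refine Finset.measurable_sum _ fun l _ => Measurable.mul_const ?_ _
  exact Finset.measurable_sum _ fun l _ => Measurable.const_mul (measurable_entry _ _) _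

lemma monomial_eval {ι : Type*} (t : ℕ) (s : ι →₀ ℕ) (hs : s.degree = t) :
    ∃ m : Fin t → ι, ∀ x : ι → ℝ, (s.prod fun i e => x i ^ e) = ∏ a, x (m a) := by
  classical
  have hl : (Finsupp.toMultiset s).toList.length = t := by
    rw [Multiset.length_toList, Finsupp.card_toMultiset, ← hs]; rfl
  refine ⟨fun a => (Finsupp.toMultiset s).toList.get (a.cast hl.symm), fun x => ?_⟩
  have h1 : (s.prod fun i e => x i ^ e) = ((Finsupp.toMultiset s).map x).prod := by
    rw [Finsupp.toMultiset_map, Finsupp.prod_toMultiset, Finsupp.prod_mapDomain_index]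
    · intro b; simp
    · intro b m₁ m₂; exact pow_add _ _ _
  rw [h1]
  conv_lhs => rw [← Multiset.coe_toList (Finsupp.toMultiset s)]
  rw [Multiset.map_coe, Multiset.prod_coe]
  subst hl
  rw [← List.prod_ofFn]
  congr 1
  apply List.ext_get <;> simp

/-- If the `t`-fusion frame potential of points `P j ∈ G_{k,d}` with weights
summing to one attains the lower bound `∫∫ tr(PR)^t dσ_{k,d}(P) dσ_{k,d}(R)`, then
`{(P j, ω j)}` is a cubature for `Hom_t(G_{k,d})`. -/
theorem cubature_of_fusionFramePotential_eq (d k t : ℕ) (hk1 : 1 ≤ k) (hkd : k ≤ d - 1)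
    (σ : Measure (Grass d k)) [IsProbabilityMeasure σ] (hσ : IsOrthInvariant σ)
    (n : ℕ) (P : Fin n → Grass d k) (ω : Fin n → ℝ) (hω : ∑ j, ω j = 1)
    (heq : ∑ i, ∑ j, ω i * ω j *
        (Matrix.trace ((P i : Matrix (Fin d) (Fin d) ℝ) * (P j : Matrix (Fin d) (Fin d) ℝ))) ^ t =
      ∫ Q : Grass d k, ∫ R : Grass d k,
        (Matrix.trace ((Q : Matrix (Fin d) (Fin d) ℝ) * (R : Matrix (Fin d) (Fin d) ℝ))) ^ t
          ∂σ ∂σ) :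
    IsCubature σ P ω t := by
  set T : (Fin t → Fin d × Fin d) → ℝ := fun m => ∫ Q : Grass d k, tens t Q.val m ∂σ with hT
  set F : Grass d k → ℝ := fun Q => ∫ R : Grass d k,
    (Matrix.trace ((Q : Matrix (Fin d) (Fin d) ℝ) * (R : Matrix (Fin d) (Fin d) ℝ))) ^ t ∂σ with hF
  have hFT : ∀ Q, F Q = ∑ m, tens t Q.val m * T m := by
    intro Q
    simp only [hF, trace_pow_eq]
    rw [integral_finsetSum _ fun m _ => (integrable_tens σ m).const_mul _]
    simp only [integral_const_mul, hT]
  have hinv : ∀ U : Matrix (Fin d) (Fin d) ℝ, ∀ hU : U ∈ Matrix.orthogonalGroup (Fin d) ℝ,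
      ∀ Q, F (conjGrass hU Q) = F Q := by
    intro U hU Q
    have hm := measurable_conjGrass (k := k) hU
    have hUU : Uᵀ * U = 1 := by
      simpa using (Matrix.mem_orthogonalGroup_iff' (Fin d) ℝ).mp hU
    simp only [hF]
    conv_lhs => rw [← hσ U hU]
    rw [integral_map hm.aemeasurable]
    · refine integral_congr_ae (Filter.Eventually.of_forall fun R => ?_)
      change (U * Q.val * Uᵀ * (U * R.val * Uᵀ)).trace ^ t = (Q.val * R.val).trace ^ t
      congr 1
      calc (U * Q.val * Uᵀ * (U * R.val * Uᵀ)).trace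
          = (U * (Q.val * (Uᵀ * U) * R.val) * Uᵀ).trace := by simp only [Matrix.mul_assoc]
        _ = _ := by rw [hUU, Matrix.trace_mul_cycle, hUU]; simp
    · rw [hσ U hU]
      simp only [trace_pow_eq]
      exact (integrable_finsetSum _ fun m _ =>
        (integrable_tens σ m).const_mul _).aestronglyMeasurable
  have hconst : ∀ Q R, F Q = F R := by
    intro Q R
    obtain ⟨U, hU, h⟩ := grass_transitive Q R
    rw [← h, hinv]
  have hc : ∀ Q, F Q = ∫ R, F R ∂σ := by
    intro Q
    rw [integral_congr_ae (Filter.Eventually.of_forall fun R => hconst R Q)]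
    simp
  set c := ∫ R, F R ∂σ with hcdef
  have hTT : ∑ m, T m * T m = c := by
    rw [hcdef]
    simp only [hFT]
    rw [integral_finsetSum _ fun m _ => (integrable_tens σ m).mul_const _]
    simp only [integral_mul_const, hT]
  have hAA : ∑ m, (∑ j, ω j * tens t (P j).val m) * (∑ j, ω j * tens t (P j).val m) = c := by
    rw [← heq]
    simp only [Finset.sum_mul_sum]
    simp only [trace_pow_eq, Finset.mul_sum]
    rw [Finset.sum_comm]
    refine Finset.sum_congr rfl fun i _ => ?_
    rw [Finset.sum_comm]
    refine Finset.sum_congr rfl fun j _ => Finset.sum_congr rfl fun m _ => by ring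
  have hAT : ∑ m, (∑ j, ω j * tens t (P j).val m) * T m = c := by
    simp only [Finset.sum_mul]
    rw [Finset.sum_comm]
    calc _ = ∑ j, ω j * F (P j) := by
          refine Finset.sum_congr rfl fun j _ => ?_
          rw [hFT, Finset.mul_sum]
          exact Finset.sum_congr rfl fun m _ => by ring
      _ = c := by simp only [hc]; rw [← Finset.sum_mul, hω, one_mul]
  have hzero : ∑ m, (T m - ∑ j, ω j * tens t (P j).val m) ^ 2 = 0 := by
    calc _ = ∑ m, (T m * T m + (∑ j, ω j * tens t (P j).val m) * (∑ j, ω j * tens t (P j).val m)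
            - 2 * ((∑ j, ω j * tens t (P j).val m) * T m)) :=
          Finset.sum_congr rfl fun m _ => by ring
      _ = 0 := by
          rw [Finset.sum_sub_distrib, Finset.sum_add_distrib, ← Finset.mul_sum, hTT, hAA, hAT]
          ring
  have hTA : ∀ m, T m = ∑ j, ω j * tens t (P j).val m := by
    intro m
    have := (Finset.sum_eq_zero_iff_of_nonneg fun m _ => sq_nonneg _).mp hzero m (Finset.mem_univ m)
    have := pow_eq_zero_iff (two_ne_zero) |>.mp this
    linarith
  intro p hp
  rw [MvPolynomial.mem_homogeneousSubmodule] at hp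
  have hmono : ∀ s ∈ p.support, ∃ m : Fin t → Fin d × Fin d, ∀ x : Fin d × Fin d → ℝ,
      (∏ i ∈ s.support, x i ^ s i) = ∏ a, x (m a) := by
    intro s hs
    refine monomial_eval t s ?_
    rw [Finsupp.degree_eq_weight_one]
    exact hp (MvPolynomial.mem_support_iff.mp hs)
  have : Nonempty (Fin d) := ⟨⟨0, by omega⟩⟩
  choose! m hm using hmono
  have hev : ∀ Q : Grass d k, MvPolynomial.eval (fun ij => Q.val ij.1 ij.2) p =
      ∑ s ∈ p.support, p.coeff s * tens t Q.val (m s) := by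
    intro Q
    rw [MvPolynomial.eval_eq]
    refine Finset.sum_congr rfl fun s hs => ?_
    rw [hm s hs]
    rfl
  simp only [hev]
  rw [integral_finsetSum _ fun s _ => (integrable_tens σ _).const_mul _]
  simp only [integral_const_mul, Finset.mul_sum]
  rw [Finset.sum_comm]
  refine Finset.sum_congr rfl fun s _ => ?_
  have := hTA (m s)
  simp only [hT] at this
  rw [this, Finset.mul_sum]
  exact Finset.sum_congr rfl fun j _ => by ring
end

section
/- Let d ≥ 2, let K = {k_1, …, k_r} ⊂ {1, …, d−1} consist of r distinct elements ordered so that min{k_1, d−k_1} ≥ min{k_2, d−k_2} ≥ … ≥ min{k_r, d−k_r}, and let t ∈ ℕ. Then, with s = min{t+1, r}, dim Pol_t(G_{K,d}) ≥ Σ_{i=1}^s dim Pol_{t−i+1}(G_{k_i,d}). -/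
open Matrix MvPolynomial

/-- Evaluation of a polynomial in the entries of a symmetric `d×d` matrix as a function on a
set `S` of matrices, as a linear map. -/
noncomputable def evalOn {d : ℕ} (S : Set (Matrix (Fin d) (Fin d) ℝ)) :
    MvPolynomial (Fin d × Fin d) ℝ →ₗ[ℝ] (S → ℝ) where
  toFun p := fun P => MvPolynomial.eval (fun ij => (P : Matrix (Fin d) (Fin d) ℝ) ij.1 ij.2) p
  map_add' p q := by funext P; simp
  map_smul' c p := by funext P; simp [MvPolynomial.smul_eval]

/-- `Pol_t(S)`: the space of restrictions to `S` of real polynomials of degree at most `t` in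
the entries of a `d×d` matrix, as a subspace of the functions `S → ℝ`. -/
noncomputable def PolOn {d : ℕ} (t : ℕ) (S : Set (Matrix (Fin d) (Fin d) ℝ)) :
    Submodule ℝ (S → ℝ) :=
  Submodule.map (evalOn S) (MvPolynomial.restrictTotalDegree (Fin d × Fin d) ℝ t)

theorem evalOn_apply' {d : ℕ} (S : Set (Matrix (Fin d) (Fin d) ℝ))
    (p : MvPolynomial (Fin d × Fin d) ℝ) (P : S) :
    evalOn S p P = MvPolynomial.eval (fun ij => (P : Matrix (Fin d) (Fin d) ℝ) ij.1 ij.2) p := rfl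

/-- Finite-dimensionality of the polynomials of bounded degree. -/
theorem finite_restrictTotalDegree (d t : ℕ) :
    Module.Finite ℝ (MvPolynomial.restrictTotalDegree (Fin d × Fin d) ℝ t) := by
  have hfin : Set.Finite {n : Fin d × Fin d →₀ ℕ | (n.sum fun _ e => e) ≤ t} := by
    refine Set.Finite.subset
      (Set.finite_Iic (Finsupp.equivFunOnFinite.symm (fun _ : Fin d × Fin d => t))) ?_
    intro n hn a
    simp only [Set.mem_setOf_eq] at hn
    rw [Finsupp.sum_fintype _ _ (by simp)] at hn
    exact (Finset.single_le_sum (f := fun a => n a) (by simp) (Finset.mem_univ a)).trans hn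
  have := hfin.to_subtype
  exact Module.Finite.of_basis
    (MvPolynomial.basisRestrictSupport ℝ {n : Fin d × Fin d →₀ ℕ | (n.sum fun _ e => e) ≤ t})

/-- The trace polynomial minus a constant. -/
noncomputable def trPoly (d : ℕ) (c : ℕ) : MvPolynomial (Fin d × Fin d) ℝ :=
  (∑ a : Fin d, X (a, a)) - C (c : ℝ)

theorem eval_trPoly (d c m : ℕ) (P : Matrix (Fin d) (Fin d) ℝ) (hP : P ∈ Grass d m) :
    MvPolynomial.eval (fun ij : Fin d × Fin d => P ij.1 ij.2) (trPoly d c) = (m : ℝ) - c := by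
  rw [← hP.2.2]
  simp [trPoly, Matrix.trace]

theorem totalDegree_trPoly (d c : ℕ) : (trPoly d c).totalDegree ≤ 1 := by
  unfold trPoly
  refine (MvPolynomial.totalDegree_sub _ _).trans (max_le ?_ (by rw [MvPolynomial.totalDegree_C]; exact zero_le_one))
  refine MvPolynomial.totalDegree_finsetSum_le ?_
  intro a _
  simp

/-- Lower bound for the dimension of the polynomial space on a union of
Grassmannians: for distinct `k 1, …, k r ∈ {1,…,d−1}` ordered so that
`min(k i, d − k i)` is nonincreasing, and `s = min(t+1, r)`,
`dim Pol_t(G_{K,d}) ≥ Σ_{i=1}^s dim Pol_{t−i+1}(G_{k i, d})`. -/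
theorem dim_pol_union_ge (d r t : ℕ) (hd : 2 ≤ d) (k : Fin r → ℕ)
    (hinj : Function.Injective k) (hk : ∀ i, 1 ≤ k i ∧ k i ≤ d - 1)
    (hord : ∀ i j : Fin r, i ≤ j → min (k j) (d - k j) ≤ min (k i) (d - k i)) :
    ∑ i : Fin (min (t + 1) r),
        Module.finrank ℝ
          (PolOn (t - (i : ℕ)) (Grass d (k (Fin.castLE (min_le_right (t + 1) r) i)))) ≤
      Module.finrank ℝ (PolOn t (⋃ i, Grass d (k i))) := by
  classical
  set s := min (t + 1) r with hs
  set κ : Fin s → ℕ := fun i => k (Fin.castLE (min_le_right (t + 1) r) i) with hκ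
  have hκinj : Function.Injective κ := hinj.comp (Fin.castLE_injective _)
  have hfinT := finite_restrictTotalDegree d
  have hfinP : ∀ t (S : Set (Matrix (Fin d) (Fin d) ℝ)), Module.Finite ℝ (PolOn t S) := by
    intro t S
    exact Module.Finite.map _ _
  -- linear sections
  have hsec : ∀ i : Fin s, ∃ σ : PolOn (t - (i : ℕ)) (Grass d (κ i)) →ₗ[ℝ]
      MvPolynomial.restrictTotalDegree (Fin d × Fin d) ℝ (t - (i : ℕ)),
      ∀ f, evalOn (Grass d (κ i)) (σ f : MvPolynomial (Fin d × Fin d) ℝ) = f := by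
    intro i
    obtain ⟨σ, hσ⟩ := LinearMap.exists_rightInverse_of_surjective
      ((evalOn (Grass d (κ i))).submoduleMap
        (MvPolynomial.restrictTotalDegree (Fin d × Fin d) ℝ (t - (i : ℕ))))
      (LinearMap.range_eq_top.2 (LinearMap.submoduleMap_surjective _ _))
    refine ⟨σ, fun f => ?_⟩
    have := congrArg Subtype.val (LinearMap.congr_fun hσ f)
    exact this
  choose σ hσ using hsec
  let Q : Fin s → MvPolynomial (Fin d × Fin d) ℝ := fun i =>
    ∏ j ∈ Finset.univ.filter (fun j : Fin s => j < i), trPoly d (κ j)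
  have hQdeg : ∀ i, (Q i).totalDegree ≤ i := by
    intro i
    refine (MvPolynomial.totalDegree_finset_prod _ _).trans ?_
    refine (Finset.sum_le_card_nsmul _ _ 1 (fun j _ => totalDegree_trPoly d _)).trans ?_
    have : (Finset.univ.filter (fun j : Fin s => j < i)) = Finset.Iio i := by ext; simp
    rw [this]
    simp
  let Ψ : (∀ i : Fin s, PolOn (t - (i : ℕ)) (Grass d (κ i))) →ₗ[ℝ]
      MvPolynomial (Fin d × Fin d) ℝ :=
    ∑ i, (LinearMap.mulLeft ℝ (Q i)) ∘ₗ (Submodule.subtype _) ∘ₗ (σ i) ∘ₗ (LinearMap.proj i)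
  have hΨ : ∀ f, Ψ f = ∑ i, Q i * (σ i (f i) : MvPolynomial (Fin d × Fin d) ℝ) := by
    intro f
    simp [Ψ]
  have hΨdeg : ∀ f, Ψ f ∈ MvPolynomial.restrictTotalDegree (Fin d × Fin d) ℝ t := by
    intro f
    rw [hΨ]
    refine Submodule.sum_mem _ fun i _ => ?_
    rw [MvPolynomial.mem_restrictTotalDegree]
    refine (MvPolynomial.totalDegree_mul _ _).trans ?_
    have h1 := hQdeg i
    have h2 := (MvPolynomial.mem_restrictTotalDegree _ _ _).1 (σ i (f i)).2
    have h3 := i.2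
    omega
  let Φ : (∀ i : Fin s, PolOn (t - (i : ℕ)) (Grass d (κ i))) →ₗ[ℝ]
      PolOn t (⋃ i, Grass d (k i)) :=
    ((evalOn (⋃ i, Grass d (k i))) ∘ₗ Ψ).codRestrict _
      (fun f => Submodule.mem_map_of_mem (hΨdeg f))
  have hΦ : Function.Injective Φ := by
    rw [← LinearMap.ker_eq_bot, LinearMap.ker_eq_bot']
    intro f hf
    have hz : ∀ P : (⋃ i, Grass d (k i) : Set _), evalOn (⋃ i, Grass d (k i)) (Ψ f) P = 0 := by
      intro P
      exact congrFun (congrArg Subtype.val hf) P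
    have key : ∀ n : ℕ, ∀ i : Fin s, (i : ℕ) = n → f i = 0 := by
      intro n
      induction n using Nat.strong_induction_on with
      | _ n ih =>
        intro i hi
        apply Subtype.ext
        funext P
        have h0 := hz ⟨P.1, Set.mem_iUnion.2 ⟨_, P.2⟩⟩
        rw [evalOn_apply', hΨ, map_sum, Finset.sum_eq_single i] at h0
        · rw [map_mul] at h0
          have h1 : MvPolynomial.eval (fun ij : Fin d × Fin d => P.1 ij.1 ij.2) (Q i) ≠ 0 := by
            simp only [Q, map_prod]
            rw [Finset.prod_ne_zero_iff]
            intro j hj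
            rw [eval_trPoly d _ _ _ P.2, sub_ne_zero]
            intro h
            have := hκinj (Nat.cast_injective h)
            simp [this] at hj
          have h2 := (mul_eq_zero.1 h0).resolve_left h1
          rw [← hσ i (f i)]
          exact h2
        · intro j _ hji
          rcases lt_or_gt_of_ne hji with h | h
          · rw [ih j (by rw [← hi]; exact h) j rfl]
            simp
          · rw [map_mul]
            refine mul_eq_zero_of_left ?_ _
            simp only [Q, map_prod]
            refine Finset.prod_eq_zero (i := i) (by simpa using h) ?_
            have := eval_trPoly d (κ i) _ _ P.2
            rw [this, sub_self]
        · simp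
    funext i
    exact key i i rfl
  have := LinearMap.finrank_le_finrank_of_injective hΦ
  rwa [Module.finrank_pi_fintype] at this
end

section
/- Let d ≥ 2, let K = {k_1, …, k_r} ⊂ {1, …, d−1} consist of r distinct elements ordered so that min{k_1, d−k_1} ≥ min{k_2, d−k_2} ≥ … ≥ min{k_r, d−k_r}, and let t ∈ ℕ. Then, with s = min{t+1, r}, dim Pol_t(G_{K,d}) = Σ_{i=1}^s dim Pol_{t−i+1}(G_{k_i,d}). -/
open Matrix MvPolynomial

/-- Chain rule for a derivation applied to `aeval`. -/
lemma chain_aeval {R A σ : Type*} [CommRing R] [CommRing A] [Algebra R A] [Fintype σ]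
    (D : Derivation R A A) (g : σ → A) (p : MvPolynomial σ R) :
    D (aeval g p) = ∑ x, aeval g (pderiv x p) * D (g x) := by
  classical
  induction p using MvPolynomial.induction_on with
  | C a => simp
  | add p q hp hq => simp [hp, hq, add_mul, Finset.sum_add_distrib]
  | mul_X p i hp =>
    simp only [map_mul, aeval_X, Derivation.leibniz, smul_eq_mul, hp, map_add, pderiv_X, add_mul,
      Finset.sum_add_distrib]
    congr 1
    · rw [Finset.sum_eq_single i]
      · simp
      · intro b _ hb; simp [Pi.single_apply, hb, hb.symm]
      · simp
    · rw [Finset.mul_sum]; refine Finset.sum_congr rfl fun x _ => by ring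

lemma poly_eval_aeval {K σ : Type*} [Field K] (γ : σ → Polynomial K) (s : K)
    (q : MvPolynomial σ K) :
    Polynomial.eval s (aeval γ q) = eval (fun x => (γ x).eval s) q := by
  induction q using MvPolynomial.induction_on with
  | C a => simp
  | add p q hp hq => simp [hp, hq]
  | mul_X p i hp => simp [hp]

/-- A polynomial whose derivative along a line vanishes takes equal values at the ends. -/
lemma eval_line {K σ : Type*} [Field K] [CharZero K] [Fintype σ] (p : MvPolynomial σ K)
    (y D : σ → K) (h : ∀ s : K, ∑ x, eval (fun x => y x + s * D x) (pderiv x p) * D x = 0) :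
    eval (fun x => y x + D x) p = eval y p := by
  obtain ⟨γ, hγ⟩ : ∃ γ : σ → Polynomial K,
    γ = fun x => Polynomial.C (y x) + Polynomial.X * Polynomial.C (D x) := ⟨_, rfl⟩
  have ev : ∀ (s : K) (q : MvPolynomial σ K),
      Polynomial.eval s (aeval γ q) = eval (fun x => y x + s * D x) q := by
    intro s q
    rw [poly_eval_aeval, hγ]
    simp only [Polynomial.eval_add, Polynomial.eval_mul, Polynomial.eval_C, Polynomial.eval_X]
  have hd : Polynomial.derivative (aeval γ p) = 0 := by
    have h1 := chain_aeval (Polynomial.derivative' (R := K)) γ p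
    have h2 : Polynomial.derivative (aeval γ p) = _ := h1
    rw [h2]
    apply Polynomial.funext
    intro s
    rw [Polynomial.eval_finsetSum]
    simp only [Polynomial.eval_mul, ev]
    simpa [Polynomial.derivative', hγ] using h s
  obtain ⟨c, hc⟩ := Polynomial.natDegree_eq_zero.1
    (Polynomial.derivative_eq_zero.1 hd)
  have e1 := ev 1 p
  have e0 := ev 0 p
  rw [← hc] at e1 e0
  simp at e1 e0
  rw [← e1, ← e0]

/-- If a polynomial vanishes along a polynomial curve, so does its velocity derivative. -/
lemma curve_deriv {K σ : Type*} [Field K] [CharZero K] [Fintype σ] (p : MvPolynomial σ K)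
    (γ : σ → Polynomial K) (h : ∀ s : K, eval (fun x => (γ x).eval s) p = 0) :
    ∑ x, eval (fun x => (γ x).eval 0) (pderiv x p) * (Polynomial.derivative (γ x)).eval 0 = 0 := by
  have ev : ∀ (s : K) (q : MvPolynomial σ K),
      Polynomial.eval s (aeval γ q) = eval (fun x => (γ x).eval s) q := by
    intro s q
    induction q using MvPolynomial.induction_on with
    | C a => simp
    | add p q hp hq => simp [hp, hq]
    | mul_X p i hp => simp [hp]
  have h0 : aeval γ p = 0 := by
    apply Polynomial.funext; intro s; rw [ev, h]; simp
  have h1 := chain_aeval (Polynomial.derivative' (R := K)) γ p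
  rw [h0, map_zero] at h1
  have := congrArg (Polynomial.eval 0) h1
  rw [Polynomial.eval_finsetSum] at this
  simp only [Polynomial.eval_mul, ev] at this
  simpa [Polynomial.derivative'] using this.symm

section Fischer
variable {σ R : Type*} [CommRing R]

/-- Multi-index factorial. -/
def mfac (α : σ →₀ ℕ) : ℕ := α.prod fun _ n => n.factorial

lemma mfac_succ (α : σ →₀ ℕ) (i : σ) :
    mfac (α + Finsupp.single i 1) = (α i + 1) * mfac α := by
  classical
  unfold mfac
  have hs : (α + Finsupp.single i 1) = (Finsupp.erase i α) + Finsupp.single i (α i + 1) := by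
    ext j
    by_cases hj : j = i
    · subst hj; simp
    · simp [Finsupp.erase_ne hj, Finsupp.single_apply, Ne.symm hj]
  have hα : α = Finsupp.erase i α + Finsupp.single i (α i) := by
    rw [Finsupp.erase_add_single]
  have hd : ∀ n : ℕ, Disjoint (Finsupp.erase i α).support (Finsupp.single i n).support := by
    intro n
    refine Finset.disjoint_left.2 fun j hj hj' => ?_
    have := Finsupp.support_single_subset hj'
    simp at this; subst this; simp at hj
  rw [hs, Finsupp.prod_add_index_of_disjoint (hd _)]
  have h2 : (α.prod fun _ n => n.factorial) = ((Finsupp.erase i α).prod fun _ n => n.factorial) *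
      (Finsupp.single i (α i)).prod fun _ n => n.factorial := by
    rw [← Finsupp.prod_add_index_of_disjoint (hd _), ← hα]
  rw [h2, Finsupp.prod_single_index (by simp), Finsupp.prod_single_index (by simp),
    Nat.factorial_succ]
  ring

/-- The Fischer bilinear form. -/
noncomputable def fis : MvPolynomial σ R →ₗ[R] MvPolynomial σ R →ₗ[R] R :=
  (basisMonomials σ R).constr R fun α => (mfac α : R) • MvPolynomial.lcoeff R α

lemma fis_monomial (α : σ →₀ ℕ) (c : R) (g : MvPolynomial σ R) :
    fis (monomial α c) g = c * (mfac α * coeff α g) := by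
  have : monomial α c = c • basisMonomials σ R α := by
    simp [smul_monomial]
  rw [this, map_smul, fis, Module.Basis.constr_basis]
  simp [MvPolynomial.lcoeff]

lemma fis_apply (f g : MvPolynomial σ R) :
    fis f g = ∑ α ∈ f.support, coeff α f * (mfac α * coeff α g) := by
  conv_lhs => rw [f.as_sum]
  rw [map_sum, LinearMap.sum_apply]
  exact Finset.sum_congr rfl fun α _ => fis_monomial _ _ _

lemma fis_comm (f g : MvPolynomial σ R) : fis f g = fis g f := by
  classical
  have key : ∀ f g : MvPolynomial σ R,
      fis f g = ∑ α ∈ f.support ∪ g.support, coeff α f * (mfac α * coeff α g) := by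
    intro f g
    rw [fis_apply]
    refine Finset.sum_subset Finset.subset_union_left ?_
    intro α _ h; simp [notMem_support_iff.1 h]
  rw [key, key g f, Finset.union_comm]
  refine Finset.sum_congr rfl fun α _ => by ring

lemma fis_X_mul (i : σ) (f g : MvPolynomial σ R) : fis (X i * f) g = fis f (pderiv i g) := by
  induction f using MvPolynomial.induction_on' with
  | monomial α c =>
    rw [X, monomial_mul, fis_monomial, fis_monomial, coeff_pderiv, add_comm, mfac_succ]
    push_cast; ring
  | add p q hp hq => simp [mul_add, hp, hq]

lemma fis_pderiv (i : σ) (f g : MvPolynomial σ R) : fis (pderiv i f) g = fis f (X i * g) := by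
  rw [fis_comm, ← fis_X_mul, fis_comm]

lemma mfac_pos (α : σ →₀ ℕ) : 0 < mfac α :=
  Finset.prod_pos fun _ _ => Nat.factorial_pos _

lemma fis_self_nonneg (f : MvPolynomial σ ℝ) : 0 ≤ fis f f := by
  rw [fis_apply]
  refine Finset.sum_nonneg fun α _ => ?_
  have := mul_self_nonneg (coeff α f)
  have h2 : (0:ℝ) ≤ mfac α := by positivity
  nlinarith

lemma fis_self_eq_zero (f : MvPolynomial σ ℝ) (h : fis f f = 0) : f = 0 := by
  by_contra hf
  obtain ⟨α, hα⟩ := support_nonempty.2 hf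
  rw [fis_apply, Finset.sum_eq_zero_iff_of_nonneg] at h
  · have := h α hα
    have h1 := mem_support_iff.1 hα
    have h2 : (mfac α : ℝ) ≠ 0 := by exact_mod_cast (mfac_pos α).ne'
    simp_all
  · intro α _
    have := mul_self_nonneg (coeff α f)
    have h2 : (0:ℝ) ≤ mfac α := by positivity
    nlinarith

/-- Coefficientwise complex conjugation. -/
noncomputable def cj : MvPolynomial σ ℂ →+* MvPolynomial σ ℂ := MvPolynomial.map (starRingEnd ℂ)

lemma cj_pderiv (i : σ) (f : MvPolynomial σ ℂ) : pderiv i (cj f) = cj (pderiv i f) := by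
  simp [cj, pderiv_map]

lemma cj_X (i : σ) : cj (X i : MvPolynomial σ ℂ) = X i := by simp [cj]

lemma fis_cj (f : MvPolynomial σ ℂ) :
    fis f (cj f) = ((∑ α ∈ f.support, (mfac α : ℝ) * Complex.normSq (coeff α f) : ℝ) : ℂ) := by
  rw [fis_apply]
  push_cast
  refine Finset.sum_congr rfl fun α _ => ?_
  rw [cj, coeff_map, Complex.normSq_eq_conj_mul_self]
  ring

lemma fis_cj_nonneg (f : MvPolynomial σ ℂ) : 0 ≤ (fis f (cj f)).re := by
  rw [fis_cj, Complex.ofReal_re]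
  exact Finset.sum_nonneg fun α _ => mul_nonneg (by positivity) (Complex.normSq_nonneg _)

lemma fis_cj_eq_zero (f : MvPolynomial σ ℂ) (h : (fis f (cj f)).re = 0) : f = 0 := by
  rw [fis_cj, Complex.ofReal_re] at h
  by_contra hf
  obtain ⟨α, hα⟩ := support_nonempty.2 hf
  rw [Finset.sum_eq_zero_iff_of_nonneg] at h
  · have := h α hα
    have h1 := mem_support_iff.1 hα
    have h2 : (mfac α : ℝ) ≠ 0 := by exact_mod_cast (mfac_pos α).ne'
    simp_all
  · exact fun α _ => mul_nonneg (by positivity) (Complex.normSq_nonneg _)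
end Fischer

/-- Null injective configurations for the bilinear form twisted by `σ`. -/
def IsNull {ι κ : Type*} [Fintype ι] [Fintype κ] (σ : ι → ι) (Y : ι → κ → ℂ) : Prop :=
  (∀ a b, ∑ i, Y i a * Y (σ i) b = 0) ∧ (∀ c : κ → ℂ, (∀ i, ∑ a, Y i a * c a = 0) → c = 0)

/-- Pluriharmonic polynomials. -/
def PH {ι κ : Type*} [Fintype ι] (σ : ι → ι) (p : MvPolynomial (ι × κ) ℂ) : Prop :=
  ∀ a b, ∑ i, pderiv (i, a) (pderiv (σ i, b) p) = 0

/-- Vanishing on null injective configurations. -/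
def VN {ι κ : Type*} [Fintype ι] [Fintype κ] (σ : ι → ι) (p : MvPolynomial (ι × κ) ℂ) : Prop :=
  ∀ Y : ι → κ → ℂ, IsNull σ Y → eval (fun x => Y x.1 x.2) p = 0

/-- The key uniqueness property. -/
def LemC {ι : Type*} (κ : Type*) [Fintype ι] [Fintype κ] (σ : ι → ι) : Prop :=
  ∀ p : MvPolynomial (ι × κ) ℂ, PH σ p → VN σ p → p = 0

lemma lemC_empty {ι κ : Type*} [Fintype ι] [Fintype κ] [IsEmpty κ] (σ : ι → ι) : LemC κ σ := by
  intro p _ h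
  apply MvPolynomial.funext
  intro x
  have := h (fun i a => x (i, a)) ⟨fun a => isEmptyElim a, fun c _ => by ext a; exact isEmptyElim a⟩
  simpa using this

lemma pderiv_comm' {R τ : Type*} [CommRing R] (i j : τ) (p : MvPolynomial τ R) :
    pderiv i (pderiv j p) = pderiv j (pderiv i p) := by
  classical
  ext m
  simp only [coeff_pderiv, Finsupp.add_apply, Finsupp.single_apply]
  by_cases h : i = j
  · subst h; ring
  · simp [h, Ne.symm h, add_right_comm m]; ring

section Step
variable {ι κ : Type*} [Fintype ι] [DecidableEq ι] [Fintype κ] [DecidableEq κ]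

/-- Extension of the involution by a hyperbolic pair. -/
def sx (σ : ι → ι) : Option (Option ι) → Option (Option ι)
  | none => some none
  | some none => none
  | some (some i) => some (some (σ i))

abbrev UU (a : κ) : Option (Option ι) × κ := (none, a)
abbrev VV (a : κ) : Option (Option ι) × κ := (some none, a)
abbrev WW (i : ι) (a : κ) : Option (Option ι) × κ := (some (some i), a)

lemma ph_iff (σ : ι → ι) (p : MvPolynomial (Option (Option ι) × κ) ℂ) :
    PH (sx σ) p ↔ ∀ a b, pderiv (UU a) (pderiv (VV b) p) + (pderiv (VV a) (pderiv (UU b) p) +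
      ∑ i, pderiv (WW i a) (pderiv (WW (σ i) b) p)) = 0 := by
  simp [PH, Fintype.sum_option, sx]

/-- The raising operators. -/
noncomputable def Xop (σ : ι → ι) (i : ι) :
    MvPolynomial (Option (Option ι) × κ) ℂ →ₗ[ℂ] MvPolynomial (Option (Option ι) × κ) ℂ where
  toFun p := ∑ c, (X (UU c) * pderiv (WW i c) p - X (WW (σ i) c) * pderiv (VV c) p)
  map_add' p q := by
    rw [← Finset.sum_add_distrib]
    refine Finset.sum_congr rfl fun c _ => by rw [map_add, map_add]; ring
  map_smul' c p := by
    simp [Finset.smul_sum, smul_sub]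

lemma Xop_apply (σ : ι → ι) (i : ι) (p : MvPolynomial (Option (Option ι) × κ) ℂ) :
    Xop σ i p = ∑ c, (X (UU c) * pderiv (WW i c) p - X (WW (σ i) c) * pderiv (VV c) p) := rfl

lemma dX (x : Option (Option ι) × κ) (σ : ι → ι) (i : ι)
    (p : MvPolynomial (Option (Option ι) × κ) ℂ) :
    pderiv x (Xop σ i p) = Xop σ i (pderiv x p) +
      ∑ c, (pderiv x (X (UU c)) * pderiv (WW i c) p - pderiv x (X (WW (σ i) c)) * pderiv (VV c) p)
      := by
  simp only [Xop_apply, map_sum, map_sub, Derivation.leibniz, smul_eq_mul]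
  rw [← Finset.sum_add_distrib]
  refine Finset.sum_congr rfl fun c _ => ?_
  rw [pderiv_comm' x, pderiv_comm' x]; ring

lemma dX_U (a : κ) (σ : ι → ι) (i : ι) (p : MvPolynomial (Option (Option ι) × κ) ℂ) :
    pderiv (UU a) (Xop σ i p) = Xop σ i (pderiv (UU a) p) + pderiv (WW i a) p := by
  rw [dX]
  congr 1
  rw [Finset.sum_eq_single a] <;> simp +contextual [pderiv_X, Pi.single_apply, eq_comm]

lemma dX_V (a : κ) (σ : ι → ι) (i : ι) (p : MvPolynomial (Option (Option ι) × κ) ℂ) :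
    pderiv (VV a) (Xop σ i p) = Xop σ i (pderiv (VV a) p) := by
  rw [dX]
  simp [pderiv_X, Pi.single_apply]

lemma dX_W (a : κ) (σ : ι → ι) (i j : ι) (p : MvPolynomial (Option (Option ι) × κ) ℂ) :
    pderiv (WW j a) (Xop σ i p) = Xop σ i (pderiv (WW j a) p) -
      if j = σ i then pderiv (VV a) p else 0 := by
  rw [dX, sub_eq_add_neg]
  congr 1
  rw [Finset.sum_eq_single a] <;> by_cases h : j = σ i <;>
    simp +contextual [pderiv_X, Pi.single_apply, eq_comm, h]

lemma ph_X (σ : ι → ι) (hσ : ∀ i, σ (σ i) = i) (i : ι)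
    (p : MvPolynomial (Option (Option ι) × κ) ℂ) (hp : PH (sx σ) p) :
    PH (sx σ) (Xop σ i p) := by
  rw [ph_iff] at hp ⊢
  intro a b
  have h := congrArg (Xop σ i) (hp a b)
  rw [map_zero, map_add, map_add, map_sum] at h
  rw [dX_V, dX_U, dX_U, map_add, dX_V]
  have e : ∀ j, σ j = σ i ↔ j = i := fun j => ⟨fun h => by rw [← hσ j, h, hσ], fun h => by rw [h]⟩
  have e2 : ∀ j, pderiv (WW j a) (pderiv (WW (σ j) b) (Xop σ i p)) =
      Xop σ i (pderiv (WW j a) (pderiv (WW (σ j) b) p)) -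
      (if j = σ i then pderiv (VV a) (pderiv (WW (σ j) b) p) else 0) -
      (if j = i then pderiv (WW j a) (pderiv (VV b) p) else 0) := by
    intro j
    rw [dX_W, map_sub, dX_W]
    simp only [e]
    by_cases hj : j = i <;> simp [hj]
  simp only [e2, Finset.sum_sub_distrib, Finset.sum_ite_eq', Finset.mem_univ, if_true, hσ]
  linear_combination h

lemma vn_X (σ : ι → ι) (hσ : ∀ i, σ (σ i) = i) (i : ι)
    (p : MvPolynomial (Option (Option ι) × κ) ℂ) (hp : VN (sx σ) p) :
    VN (sx σ) (Xop σ i p) := by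
  intro Y hY
  have hc := curve_deriv p (fun x => match x with
    | (none, a) => Polynomial.C (Y none a)
    | (some none, a) => Polynomial.C (Y (some none) a)
        - Polynomial.X * Polynomial.C (Y (some (some (σ i))) a)
        - Polynomial.X * Polynomial.X * Polynomial.C ((if σ i = i then 1/2 else 0) * Y none a)
    | (some (some j), a) => Polynomial.C (Y (some (some j)) a) +
        Polynomial.X * Polynomial.C (if j = i then Y none a else 0)) ?_
  · have e : (fun x : Option (Option ι) × κ => Polynomial.eval (0:ℂ) (match x with
      | (none, a) => Polynomial.C (Y none a)
      | (some none, a) => Polynomial.C (Y (some none) a)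
        - Polynomial.X * Polynomial.C (Y (some (some (σ i))) a)
        - Polynomial.X * Polynomial.X * Polynomial.C ((if σ i = i then 1/2 else 0) * Y none a)
      | (some (some j), a) => Polynomial.C (Y (some (some j)) a) +
        Polynomial.X * Polynomial.C (if j = i then Y none a else 0))) = fun x => Y x.1 x.2 := by
      funext x
      rcases x with ⟨_ | _ | j, a⟩ <;> simp
    rw [e] at hc
    rw [Xop_apply, map_sum]
    rw [Fintype.sum_prod_type, Fintype.sum_option, Fintype.sum_option] at hc
    simp only [Polynomial.derivative_C, Polynomial.derivative_add, Polynomial.derivative_sub,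
      Polynomial.derivative_mul, Polynomial.derivative_X, Polynomial.eval_add, Polynomial.eval_sub,
      Polynomial.eval_mul, Polynomial.eval_X, Polynomial.eval_C, Polynomial.eval_zero,
      Polynomial.eval_one] at hc
    simp only [mul_zero, zero_mul, add_zero, zero_add, sub_zero, one_mul, mul_ite,
      Finset.sum_const_zero, zero_sub] at hc
    rw [Finset.sum_comm (s := Finset.univ (α := ι))] at hc
    simp only [Finset.sum_ite_eq', Finset.mem_univ, if_true] at hc
    rw [← hc, ← Finset.sum_add_distrib]
    refine Finset.sum_congr rfl fun c _ => ?_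
    simp; ring
  · intro s
    have := hp (fun i' a => match i' with
      | none => Y none a
      | some none => Y (some none) a - s * Y (some (some (σ i))) a
          - s * s * ((if σ i = i then 1/2 else 0) * Y none a)
      | some (some j) => Y (some (some j)) a + s * (if j = i then Y none a else 0)) ?_
    · refine Eq.trans ?_ this
      congr 1
      apply congrArg
      funext x
      rcases x with ⟨_ | _ | j, a⟩ <;>
      simp only [Polynomial.eval_add, Polynomial.eval_sub,
        Polynomial.eval_mul, Polynomial.eval_X, Polynomial.eval_C]
    · constructor
      · intro a b
        have h0 := hY.1 a b
        simp only [Fintype.sum_option, sx] at h0 ⊢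
        have e : ∀ j, σ j = i ↔ j = σ i :=
          fun j => ⟨fun h => by rw [← hσ j, h], fun h => by rw [h, hσ]⟩
        have e1 : ∀ j, (Y (some (some j)) a + s * (if j = i then Y none a else 0)) *
          (Y (some (some (σ j))) b + s * (if σ j = i then Y none b else 0)) =
          Y (some (some j)) a * Y (some (some (σ j))) b +
          (if j = i then s * Y none a * Y (some (some (σ j))) b else 0) +
          (if j = σ i then s * Y (some (some j)) a * Y none b else 0) +
          (if j = i then (if j = σ i then s * s * Y none a * Y none b else 0) else 0) := by
          intro j
          simp only [e]
          split_ifs <;> ring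
        simp only [e1, Finset.sum_add_distrib, Finset.sum_ite_eq', Finset.mem_univ, if_true]
        by_cases hi : σ i = i
        · simp only [hi, if_true] at h0 ⊢
          linear_combination h0
        · simp only [hi, Ne.symm hi, if_false] at h0 ⊢
          linear_combination h0
      · intro c hc
        apply hY.2 c
        have hu : ∑ a, Y none a * c a = 0 := hc none
        have hw : ∀ j, ∑ a, Y (some (some j)) a * c a = 0 := by
          intro j
          have := hc (some (some j))
          simp only [add_mul, Finset.sum_add_distrib] at this
          by_cases hj : j = i
          · simp only [hj, if_true, mul_assoc, ← Finset.mul_sum, hu] at this ⊢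
            simpa using this
          · simpa [hj] using this
        rintro (_ | _ | j)
        · exact hu
        · have := hc (some none)
          simp only [sub_mul, Finset.sum_sub_distrib, mul_assoc, ← Finset.mul_sum, hu, hw] at this
          simpa using this
        · exact hw j
end Step

section Raise
variable {τ : Type*}

/-- Polynomials of bounded degree and weight bounded below. -/
noncomputable def MW (w : τ → ℕ) (n j : ℕ) : Submodule ℂ (MvPolynomial τ ℂ) :=
  restrictSupport ℂ {α | Finsupp.degree α ≤ n ∧ j ≤ Finsupp.weight w α}

lemma MW_raise (w : τ → ℕ) (n j : ℕ) (x y : τ) (h : w x = w y + 1) (p : MvPolynomial τ ℂ)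
    (hp : p ∈ MW w n j) : X x * pderiv y p ∈ MW w n (j + 1) := by
  have : MW w n j ≤ (MW w n (j+1)).comap
      ((LinearMap.mulLeft ℂ (X x : MvPolynomial τ ℂ)).comp (pderiv y : Derivation ℂ (MvPolynomial τ ℂ) (MvPolynomial τ ℂ)).toLinearMap) := by
    rw [MW, restrictSupport_eq_span, Submodule.span_le]
    rintro _ ⟨α, ⟨h1, h2⟩, rfl⟩
    simp only [SetLike.mem_coe, Submodule.mem_comap, LinearMap.comp_apply, LinearMap.mulLeft_apply,
      Derivation.coeFn_coe]
    rw [pderiv_monomial]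
    by_cases hα : α y = 0
    · simp [hα]
    · rw [X, monomial_mul, MW, monomial_mem_restrictSupport]
      left
      have e : α = (α - Finsupp.single y 1) + Finsupp.single y 1 := by
        rw [tsub_add_cancel_of_le]
        rw [Finsupp.single_le_iff]; omega
      generalize α - Finsupp.single y 1 = β at e
      subst e
      simp only [map_add, Finsupp.degree_single, Finsupp.weight_single, smul_eq_mul, one_mul, h,
        Set.mem_ofPred_eq] at h1 h2 ⊢
      omega
  exact this hp

lemma MW_top (w : τ → ℕ) (hw : ∀ x, w x ≤ 2) (n : ℕ) (p : MvPolynomial τ ℂ)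
    (hp : p ∈ MW w n (2 * n + 1)) : p = 0 := by
  rw [MW, mem_restrictSupport_iff] at hp
  by_contra h
  obtain ⟨α, hα⟩ := support_nonempty.2 h
  obtain ⟨h1, h2⟩ := hp hα
  have : Finsupp.weight w α ≤ 2 * Finsupp.degree α := by
    rw [Finsupp.weight_apply, Finsupp.degree_apply, Finsupp.sum, Finset.mul_sum]
    refine Finset.sum_le_sum fun i _ => ?_
    rw [smul_eq_mul, mul_comm]
    exact Nat.mul_le_mul_right _ (hw i)
  omega
end Raise

section Step
variable {ι κ : Type*} [Fintype ι] [DecidableEq ι] [Fintype κ] [DecidableEq κ]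

/-- The weight. -/
def wgt : Option (Option ι) × κ → ℕ
  | (none, _) => 2
  | (some none, _) => 0
  | (some (some _), _) => 1

lemma exists_killed (σ : ι → ι) (hσ : ∀ i, σ (σ i) = i)
    (p : MvPolynomial (Option (Option ι) × κ) ℂ) (h1 : PH (sx σ) p) (h2 : VN (sx σ) p)
    (h3 : p ≠ 0) : ∃ q : MvPolynomial (Option (Option ι) × κ) ℂ,
      PH (sx σ) q ∧ VN (sx σ) q ∧ q ≠ 0 ∧ ∀ i, Xop σ i q = 0 := by
  have key : ∀ (n m j : ℕ) (p : MvPolynomial (Option (Option ι) × κ) ℂ), PH (sx σ) p →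
      VN (sx σ) p → p ≠ 0 → p ∈ MW wgt n j → j + m = 2 * n + 1 →
      ∃ q : MvPolynomial (Option (Option ι) × κ) ℂ,
      PH (sx σ) q ∧ VN (sx σ) q ∧ q ≠ 0 ∧ ∀ i, Xop σ i q = 0 := by
    intro n m
    induction m with
    | zero =>
      intro j p _ _ h3 h4 h5
      rw [add_zero] at h5
      subst h5
      exact absurd (MW_top wgt (by rintro ⟨_ | _ | _, _⟩ <;> simp [wgt]) n p h4) h3
    | succ m ih =>
      intro j p h1 h2 h3 h4 h5
      by_cases hX : ∀ i, Xop σ i p = 0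
      · exact ⟨p, h1, h2, h3, hX⟩
      · push Not at hX
        obtain ⟨i, hi⟩ := hX
        refine ih (j + 1) _ (ph_X σ hσ i p h1) (vn_X σ hσ i p h2) hi ?_ (by omega)
        rw [Xop_apply]
        refine Submodule.sum_mem _ fun c _ => Submodule.sub_mem _ ?_ ?_
        · exact MW_raise wgt n j (UU c) (WW i c) (by simp [wgt]) p h4
        · exact MW_raise wgt n j (WW (σ i) c) (VV c) (by simp [wgt]) p h4
  refine key p.totalDegree _ 0 p h1 h2 h3 ?_ (zero_add _)
  rw [MW, mem_restrictSupport_iff]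
  intro α hα
  refine ⟨?_, Nat.zero_le _⟩
  rw [Finsupp.degree_apply]
  exact le_totalDegree hα

lemma pairing (σ : ι → ι) (hσ : ∀ i, σ (σ i) = i)
    (p : MvPolynomial (Option (Option ι) × κ) ℂ) (h1 : PH (sx σ) p)
    (hX : ∀ i, Xop σ i p = 0) (i : ι) : ∑ a, X (WW i a) * pderiv (VV a) p = 0 := by
  rw [ph_iff] at h1
  set q : κ → MvPolynomial (Option (Option ι) × κ) ℂ := fun a => pderiv (VV a) p with hq
  set S : κ → κ → MvPolynomial (Option (Option ι) × κ) ℂ :=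
    fun a b => pderiv (UU a) (q b) + pderiv (UU b) (q a) with hS
  set Rr : ι → MvPolynomial (Option (Option ι) × κ) ℂ := fun i => ∑ a, X (WW i a) * q a with hR
  have hmain : ∀ b, ∑ c, X (UU c) * S c b + ∑ i, pderiv (WW i b) (Rr i) = 0 := by
    intro b
    have e1 : ∀ i, ∑ c, X (UU c) * pderiv (WW i c) (pderiv (WW (σ i) b) p) =
        pderiv (WW (σ i) b) (Rr (σ i)) := by
      intro i
      have h := congrArg (pderiv (WW (σ i) b)) (hX i)
      rw [Xop_apply, Finset.sum_sub_distrib, map_sub, map_zero, sub_eq_zero] at h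
      rw [hR]
      refine Eq.trans ?_ h
      rw [map_sum]
      refine Finset.sum_congr rfl fun c _ => ?_
      rw [Derivation.leibniz, pderiv_X_of_ne (by simp [UU, WW]), smul_zero, add_zero, smul_eq_mul,
        pderiv_comm']
    have e2 : ∑ i, pderiv (WW i b) (Rr i) = ∑ i, pderiv (WW (σ i) b) (Rr (σ i)) :=
      (Equiv.sum_comp (Function.Involutive.toPerm σ hσ) fun i => pderiv (WW i b) (Rr i)).symm
    rw [e2]
    simp only [← e1]
    rw [Finset.sum_comm, ← Finset.sum_add_distrib]
    refine Finset.sum_eq_zero fun c _ => ?_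
    rw [← Finset.mul_sum, ← mul_add]
    have := h1 c b
    rw [hS, hq]
    simp only []
    rw [pderiv_comm' (VV c) (UU b)] at this
    rw [add_assoc, this, mul_zero]
  have hsum : ∑ b, fis (∑ c, X (UU c) * S c b + ∑ i, pderiv (WW i b) (Rr i)) (cj (q b)) = 0 := by
    simp [hmain]
  have eR : ∑ b, fis (∑ i, pderiv (WW i b) (Rr i)) (cj (q b)) = ∑ i, fis (Rr i) (cj (Rr i)) := by
    simp only [map_sum, LinearMap.sum_apply, fis_pderiv]
    rw [Finset.sum_comm]
    refine Finset.sum_congr rfl fun i _ => ?_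
    rw [← map_sum]
    congr 1
    simp [hR, cj_X]
  have eS0 : ∑ b, fis (∑ c, X (UU c) * S c b) (cj (q b)) =
      ∑ b, ∑ c, fis (S c b) (cj (pderiv (UU c) (q b))) := by
    simp only [map_sum, LinearMap.sum_apply, fis_X_mul, cj_pderiv]
  have eS1 : ∑ b, ∑ c, fis (S c b) (cj (pderiv (UU c) (q b))) =
      ∑ b, ∑ c, fis (S c b) (cj (pderiv (UU b) (q c))) := by
    rw [Finset.sum_comm]
    refine Finset.sum_congr rfl fun b _ => Finset.sum_congr rfl fun c _ => ?_
    have : S c b = S b c := by simp only [hS]; ring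
    rw [this]
  have eS : 2 * ∑ b, fis (∑ c, X (UU c) * S c b) (cj (q b)) =
      ∑ b, ∑ c, fis (S c b) (cj (S c b)) := by
    rw [two_mul]
    nth_rewrite 2 [eS0]
    rw [eS0, eS1, ← eS1]
    nth_rewrite 2 [eS1]
    rw [← Finset.sum_add_distrib]
    refine Finset.sum_congr rfl fun b _ => ?_
    rw [← Finset.sum_add_distrib]
    refine Finset.sum_congr rfl fun c _ => ?_
    rw [← map_add, ← map_add]
  have hfin : ∑ b, ∑ c, fis (S c b) (cj (S c b)) + 2 * ∑ i, fis (Rr i) (cj (Rr i)) = 0 := by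
    rw [← eS, ← eR, ← mul_add, ← Finset.sum_add_distrib]
    simp only [map_add, LinearMap.add_apply] at hsum
    rw [hsum, mul_zero]
  have hre := congrArg Complex.re hfin
  simp only [Complex.add_re, Complex.re_sum, Complex.mul_re, Complex.re_ofNat, Complex.im_ofNat,
    zero_mul, sub_zero, Complex.zero_re] at hre
  have n1 : 0 ≤ ∑ b, ∑ c, (fis (S c b) (cj (S c b))).re :=
    Finset.sum_nonneg fun _ _ => Finset.sum_nonneg fun _ _ => fis_cj_nonneg _
  have n2 : 0 ≤ ∑ i, (fis (Rr i) (cj (Rr i))).re :=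
    Finset.sum_nonneg fun _ _ => fis_cj_nonneg _
  have z : ∑ i, (fis (Rr i) (cj (Rr i))).re = 0 := by linarith
  rw [Finset.sum_eq_zero_iff_of_nonneg fun _ _ => fis_cj_nonneg _] at z
  exact fis_cj_eq_zero _ (z i (Finset.mem_univ i))

lemma q_zero_of_card (h : Fintype.card κ ≤ Fintype.card ι)
    (q : κ → MvPolynomial (Option (Option ι) × κ) ℂ)
    (hq : ∀ i, ∑ a, X (WW i a) * q a = 0) : q = 0 := by
  obtain ⟨e⟩ := Function.Embedding.nonempty_of_card_le h
  let M : Matrix κ κ (MvPolynomial (Option (Option ι) × κ) ℂ) := fun a b => X (WW (e a) b)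
  refine Matrix.eq_zero_of_mulVec_eq_zero (M := M) ?_ ?_
  · intro hdet
    have := congrArg (eval fun x : Option (Option ι) × κ => if x.1 = some (some (e x.2)) then (1:ℂ)
      else 0) hdet
    rw [RingHom.map_det, map_zero] at this
    have e1 : (eval fun x : Option (Option ι) × κ => if x.1 = some (some (e x.2)) then (1:ℂ)
      else 0).mapMatrix M = 1 := by
      ext a b
      rw [RingHom.mapMatrix_apply, Matrix.map_apply]
      simp [M, Matrix.one_apply]
    rw [e1] at this
    simp at this
  · funext a
    exact hq (e a)
end Step

section Step
variable {ι κ : Type*} [Fintype ι] [DecidableEq ι] [Fintype κ] [DecidableEq κ]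

lemma q_zero_degenerate [IsEmpty ι] [Unique κ] (σ : ι → ι)
    (p : MvPolynomial (Option (Option ι) × κ) ℂ) (h1 : PH (sx σ) p) (h2 : VN (sx σ) p) (a : κ) :
    pderiv (VV a) p = 0 := by
  obtain rfl : a = default := Subsingleton.elim _ _
  rw [ph_iff] at h1
  have h1' : pderiv (UU default) (pderiv (VV default) p) = 0 := by
    have := h1 default default
    rw [pderiv_comm' (VV default)] at this
    simp only [Finset.univ_eq_empty, Finset.sum_empty, add_zero] at this
    have h2 : (2:ℂ) • pderiv (UU default) (pderiv (VV default) p) = 0 := by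
      rw [two_smul]; exact this
    exact (smul_eq_zero.1 h2).resolve_left two_ne_zero
  obtain ⟨γ, hγ⟩ : ∃ γ : Option (Option ι) × κ → Polynomial ℂ,
    γ = fun x => if x.1 = none then 0 else Polynomial.X := ⟨_, rfl⟩
  have hz : ∀ s : ℂ, s ≠ 0 → eval (fun x => (γ x).eval s) p = 0 := by
    intro s hs
    refine Eq.trans ?_ (h2 (fun i _ => if i = none then 0 else s) ⟨?_, ?_⟩)
    · congr 1
      apply congrArg
      funext x
      rw [hγ]
      by_cases hx : x.1 = none <;> simp [hx]
    · intro a b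
      rw [Fintype.sum_option, Fintype.sum_option]
      simp [show sx σ none = some none from rfl, show sx σ (some none) = none from rfl]
    · intro c hc
      have := hc (some none)
      funext a
      rw [Subsingleton.elim a default]
      simpa [hs] using this
  have hz' : aeval γ p = 0 := by
    have : Polynomial.X * aeval γ p = 0 := by
      apply Polynomial.funext
      intro s
      rw [Polynomial.eval_mul, poly_eval_aeval]
      by_cases hs : s = 0
      · simp [hs]
      · simp [hz s hs]
    exact (mul_eq_zero.1 this).resolve_left Polynomial.X_ne_zero
  have hc := chain_aeval (Polynomial.derivative' (R := ℂ)) γ p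
  rw [hz', map_zero, Fintype.sum_prod_type, Fintype.sum_option, Fintype.sum_option] at hc
  have hq : aeval γ (pderiv (VV default) p) = 0 := by
    simpa [hγ, Polynomial.derivative'] using hc.symm
  apply MvPolynomial.funext
  intro y
  rw [map_zero]
  have hl := eval_line (pderiv (VV default) p) y (fun x => if x.1 = none then - y x else 0) ?_
  · rw [← hl]
    have := congrArg (Polynomial.eval (y (VV default))) hq
    rw [poly_eval_aeval] at this
    rw [Polynomial.eval_zero] at this
    refine Eq.trans ?_ this
    congr 1
    apply congrArg
    funext x
    rcases x with ⟨_ | _ | i, a⟩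
    · simp [hγ]
    · simp [hγ, Subsingleton.elim a default]
    · exact isEmptyElim i
  · intro s
    rw [Fintype.sum_prod_type, Fintype.sum_option, Fintype.sum_option]
    simp [h1']

/-- The substitution used for restricting to a smaller configuration. -/
noncomputable def gsub (u : Option κ → ℂ) :
    Option (Option ι) × Option κ → MvPolynomial (ι × κ) ℂ
  | (none, a) => C (u a)
  | (some none, _) => 0
  | (some (some _), none) => 0
  | (some (some i), some b) => X (i, b)

lemma pderiv_gsub (u : Option κ → ℂ) (j : ι) (b : κ)
    (q : MvPolynomial (Option (Option ι) × Option κ) ℂ) :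
    pderiv (j, b) (aeval (gsub u) q) = aeval (gsub u) (pderiv (WW j (some b)) q) := by
  rw [chain_aeval]
  rw [Finset.sum_eq_single (WW j (some b))]
  · simp [gsub]
  · rintro ⟨_ | _ | i, _ | c⟩ _ hx <;> simp [gsub] at hx ⊢
    right
    rw [Pi.single_apply, if_neg]
    simpa using hx
  · simp

/-- The configuration attached to `gsub`. -/
def ysub (u : Option κ → ℂ) (Y : ι → κ → ℂ) : Option (Option ι) → Option κ → ℂ
  | none, a => u a
  | some none, _ => 0
  | some (some _), none => 0
  | some (some i), some b => Y i b

lemma eval_gsub (u : Option κ → ℂ) (Y : ι → κ → ℂ)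
    (q : MvPolynomial (Option (Option ι) × Option κ) ℂ) :
    eval (fun x => Y x.1 x.2) (aeval (gsub u) q) = eval (fun x => ysub u Y x.1 x.2) q := by
  induction q using MvPolynomial.induction_on with
  | C a => simp
  | add p q hp hq => rw [map_add, map_add, map_add, hp, hq]
  | mul_X p x hp =>
    rw [map_mul, map_mul, map_mul, hp, aeval_X, eval_X]
    congr 1
    rcases x with ⟨_ | _ | i, _ | c⟩ <;> simp [gsub, ysub]

theorem lemC_step (σ : ι → ι) (hσ : ∀ i, σ (σ i) = i)
    (hcard : 2 * Fintype.card κ ≤ Fintype.card ι) (IH : LemC κ σ) :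
    LemC (Option κ) (sx σ) := by
  intro p0 h01 h02
  by_contra h03
  obtain ⟨p, h1, h2, h3, hX⟩ := exists_killed σ hσ p0 h01 h02 h03
  apply h3
  have hV : ∀ a, pderiv (VV a) p = 0 := by
    by_cases hc : Fintype.card (Option κ) ≤ Fintype.card ι
    · exact fun a => congrFun (q_zero_of_card hc (fun a => pderiv (VV a) p)
        (pairing σ hσ p h1 hX)) a
    · rw [Fintype.card_option] at hc
      have e1 : Fintype.card ι = 0 := by omega
      have e2 : Fintype.card κ = 0 := by omega
      haveI := Fintype.card_eq_zero_iff.1 e1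
      haveI := Fintype.card_eq_zero_iff.1 e2
      exact q_zero_degenerate σ p h1 h2
  have hU : ∀ i, ∑ a, X (UU a) * pderiv (WW i a) p = 0 := by
    intro i
    have := hX i
    rw [Xop_apply] at this
    simpa [hV] using this
  have hW : ∀ a b, ∑ i, pderiv (WW i a) (pderiv (WW (σ i) b) p) = 0 := by
    intro a b
    have := (ph_iff σ p).1 h1 a b
    rw [pderiv_comm' (VV a)] at this
    simpa [hV] using this
  have hsub : ∀ u : Option κ → ℂ, u none ≠ 0 → aeval (gsub (ι := ι) u) p = 0 := by
    intro u hu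
    apply IH
    · intro a b
      simp only [pderiv_gsub]
      rw [← map_sum, hW, map_zero]
    · intro Y hY
      rw [eval_gsub]
      apply h2
      constructor
      · rintro (_ | a) (_ | b) <;> simp [Fintype.sum_option, sx, ysub, hY.1]
      · intro c hc
        have e1 : (fun b => c (some b)) = 0 := by
          apply hY.2
          intro i
          simpa [Fintype.sum_option, ysub] using hc (some (some i))
        have e2 : ∀ b, c (some b) = 0 := fun b => congrFun e1 b
        have := hc none
        rw [Fintype.sum_option] at this
        simp [e2, ysub, hu] at this
        funext a
        rcases a with _ | b
        · exact this
        · exact e2 b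
  have hmul : X (UU none) * p = 0 := by
    apply MvPolynomial.funext
    intro y
    rw [map_mul, eval_X, map_zero]
    by_cases hu : y (UU none) = 0
    · rw [hu, zero_mul]
    · have hl := eval_line p y (fun x => match x with
        | (none, _) => 0
        | (some none, a) => - y (VV a)
        | (some (some i), a) => - (y (WW i none) / y (UU none)) * y (UU a)) ?_
      · rw [← hl]
        have h5 := hsub (fun a => y (UU a)) hu
        have h6 := eval_gsub (fun a => y (UU a)) (fun (i : ι) b => y (WW i (some b)) -
          (y (WW i none) / y (UU none)) * y (UU (some b))) p
        rw [h5, map_zero] at h6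
        rw [mul_eq_zero]
        right
        refine Eq.trans ?_ h6.symm
        congr 1
        apply congrArg
        funext x
        rcases x with ⟨_ | _ | i, _ | c⟩ <;> simp [ysub]
        · field_simp; ring
        · ring
      · intro s
        rw [Fintype.sum_prod_type, Fintype.sum_option, Fintype.sum_option (α := ι)]
        simp only [mul_zero, Finset.sum_const_zero, zero_add, hV, map_zero, zero_mul]
        refine Finset.sum_eq_zero fun i _ => ?_
        have := congrArg (eval (fun x : Option (Option ι) × Option κ => y x + s * (match x with
        | (none, _) => 0
        | (some none, a) => - y (VV a)
        | (some (some i), a) => - (y (WW i none) / y (UU none)) * y (UU a)))) (hU i)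
        rw [map_sum, map_zero] at this
        simp only [map_mul, eval_X] at this
        have this2 := congrArg (fun z => (- (y (WW i none) / y (UU none))) * z) this
        simp only [mul_zero, add_zero] at this2
        refine Eq.trans ?_ this2
        rw [Finset.mul_sum]
        refine Finset.sum_congr rfl fun a _ => ?_
        ring
  exact (mul_eq_zero.1 hmul).resolve_left (X_ne_zero _)

end Step

/-- Columns of the change of basis. -/
theorem exists_LemC (c m : ℕ) : ∃ (ι κ : Type) (_ : Fintype ι) (_ : DecidableEq ι)
    (_ : Fintype κ) (_ : DecidableEq κ) (σ : ι → ι) (T : ι → ι → ℂ),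
    (∀ i, σ (σ i) = i) ∧ Fintype.card ι = c + 2 * m ∧ Fintype.card κ = m ∧ LemC κ σ ∧
    ∀ j k, ∑ i, T j i * T k (σ i) = if j = k then 1 else 0 := by
  induction m with
  | zero =>
    refine ⟨Fin c, Fin 0, inferInstance, inferInstance, inferInstance, inferInstance, id,
      fun i j => if i = j then 1 else 0, fun _ => rfl, by simp, by simp, lemC_empty _, ?_⟩
    intro j k
    simp [eq_comm]
  | succ m ih =>
    obtain ⟨ι, κ, _, _, _, _, σ, T, hσ, h1, h2, h3, h4⟩ := ih
    refine ⟨Option (Option ι), Option κ, inferInstance, inferInstance, inferInstance, inferInstance,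
      sx σ, fun j i => match j, i with
        | none, none => 1
        | none, some none => 1/2
        | some none, none => Complex.I
        | some none, some none => - Complex.I / 2
        | some (some j), some (some i) => T j i
        | _, _ => 0, ?_, ?_, ?_, ?_, ?_⟩
    · rintro (_ | _ | i) <;> simp [sx, hσ]
    · simp [h1]; ring
    · simp [h2]
    · exact lemC_step σ hσ (by omega) h3
    · rintro (_ | _ | j) (_ | _ | k) <;> simp [Fintype.sum_option, sx, h4]
      · norm_num
      · ring
      · ring
      · linear_combination (-1:ℂ) * Complex.I_mul_I

section Mev
variable {d : ℕ} {A B : Type*} [CommRing A] [Algebra ℝ A] [CommRing B] [Algebra ℝ B]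

/-- Evaluation of a real polynomial at a matrix with entries in a real algebra. -/
noncomputable def mev (M : Matrix (Fin d) (Fin d) A) : MvPolynomial (Fin d × Fin d) ℝ →ₐ[ℝ] A :=
  aeval fun x => M x.1 x.2

lemma mev_X (M : Matrix (Fin d) (Fin d) A) (x : Fin d × Fin d) : mev M (X x) = M x.1 x.2 := by
  simp [mev]

lemma eval_eq_mev (P : Matrix (Fin d) (Fin d) ℝ) (f : MvPolynomial (Fin d × Fin d) ℝ) :
    eval (fun ij => P ij.1 ij.2) f = mev P f := by
  simp [mev, aeval_eq_eval]

lemma mev_map (φ : A →ₐ[ℝ] B) (M : Matrix (Fin d) (Fin d) A) (f : MvPolynomial (Fin d × Fin d) ℝ) :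
    φ (mev M f) = mev (M.map φ) f := by
  have : φ.comp (mev M) = mev (M.map φ) := by
    apply MvPolynomial.algHom_ext
    intro x
    simp [mev]
  rw [← this]; rfl

lemma mev_smul_hom (n : ℕ) (f : MvPolynomial (Fin d × Fin d) ℝ) (hf : f.IsHomogeneous n) (r : A)
    (M : Matrix (Fin d) (Fin d) A) : mev (r • M) f = r ^ n * mev M f := by
  rw [f.as_sum, map_sum, map_sum, Finset.mul_sum]
  refine Finset.sum_congr rfl fun α hα => ?_
  have hd : Finsupp.degree α = n := by
    by_contra h
    exact (mem_support_iff.1 hα) (hf.coeff_eq_zero h)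
  simp only [mev, aeval_monomial, Matrix.smul_apply, smul_eq_mul]
  rw [← hd, Finsupp.degree_apply, Finsupp.prod, Finsupp.prod]
  simp only [mul_pow, Finset.prod_mul_distrib, Finset.prod_pow_eq_pow_sum]
  ring

/-- Homogenisation. -/
noncomputable def Hf (n : ℕ) (f : MvPolynomial (Fin d × Fin d) ℝ) (r : A)
    (M : Matrix (Fin d) (Fin d) A) : A :=
  ∑ e ∈ Finset.range (n + 1), r ^ (n - e) * mev M (homogeneousComponent e f)

lemma Hf_smul (n : ℕ) (f : MvPolynomial (Fin d × Fin d) ℝ) (hf : f.totalDegree ≤ n) (r : A)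
    (M : Matrix (Fin d) (Fin d) A) : Hf n f r (r • M) = r ^ n * mev M f := by
  have h : f = ∑ e ∈ Finset.range (n + 1), homogeneousComponent e f := by
    conv_lhs => rw [← sum_homogeneousComponent f]
    refine Finset.sum_subset (fun e he => ?_) (fun e _ he => ?_)
    · simp at he ⊢; omega
    · apply homogeneousComponent_eq_zero
      simp at he; omega
  conv_rhs => rw [h]
  rw [map_sum, Finset.mul_sum, Hf]
  refine Finset.sum_congr rfl fun e he => ?_
  rw [mev_smul_hom e _ (homogeneousComponent_isHomogeneous e f), ← mul_assoc, ← pow_add]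
  congr 2
  simp at he; omega

lemma Hf_map (φ : A →ₐ[ℝ] B) (n : ℕ) (f : MvPolynomial (Fin d × Fin d) ℝ) (r : A)
    (M : Matrix (Fin d) (Fin d) A) : φ (Hf n f r M) = Hf n f (φ r) (M.map φ) := by
  simp [Hf, mev_map]

lemma Hf_zero (n : ℕ) (f : MvPolynomial (Fin d × Fin d) ℝ) (M : Matrix (Fin d) (Fin d) A) :
    Hf n f 0 M = mev M (homogeneousComponent n f) := by
  rw [Hf, Finset.sum_eq_single n]
  · simp
  · intro e he hn
    have : n - e ≠ 0 := by simp at he; omega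
    simp [this]
  · simp

lemma Hf_one (n : ℕ) (f : MvPolynomial (Fin d × Fin d) ℝ) (hf : f.totalDegree ≤ n)
    (M : Matrix (Fin d) (Fin d) A) : Hf n f 1 M = mev M f := by
  have := Hf_smul n f hf 1 M
  simpa using this
end Mev

section Dens
variable {d : ℕ} {κ : Type*} [Fintype κ] [DecidableEq κ]

lemma proj_mem (Y : Matrix (Fin d) κ ℝ) (h : (Yᵀ * Y).det ≠ 0) :
    Y * (Yᵀ * Y)⁻¹ * Yᵀ ∈ Grass d (Fintype.card κ) := by
  have hu : IsUnit (Yᵀ * Y).det := isUnit_iff_ne_zero.2 h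
  refine ⟨?_, ?_, ?_⟩
  · rw [Matrix.IsSymm, transpose_mul, transpose_mul, transpose_transpose, transpose_nonsing_inv,
      transpose_mul, transpose_transpose, Matrix.mul_assoc]
  · calc Y * (Yᵀ * Y)⁻¹ * Yᵀ * (Y * (Yᵀ * Y)⁻¹ * Yᵀ) =
        Y * ((Yᵀ * Y)⁻¹ * (Yᵀ * Y)) * (Yᵀ * Y)⁻¹ * Yᵀ := by simp only [Matrix.mul_assoc]
      _ = _ := by rw [nonsing_inv_mul _ hu, Matrix.mul_one]
  · rw [Matrix.mul_assoc, trace_mul_comm, Matrix.mul_assoc, nonsing_inv_mul _ hu, trace_one]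

lemma dens (n : ℕ) (f : MvPolynomial (Fin d × Fin d) ℝ) (hn : f.totalDegree ≤ n) (ε δ : ℝ)
    (hf : ∀ P ∈ Grass d (Fintype.card κ), mev (ε • P + δ • (1 : Matrix _ _ ℝ)) f = 0)
    (Q : Matrix (Fin d) κ ℂ) (hQ : Qᵀ * Q = 1) :
    mev (ε • (Q * Qᵀ) + δ • (1 : Matrix _ _ ℂ)) f = 0 := by
  let Yt : Matrix (Fin d) κ (MvPolynomial (Fin d × κ) ℝ) := fun i a => X (i, a)
  let D := (Ytᵀ * Yt).det
  let N := ε • (Yt * (Ytᵀ * Yt).adjugate * Ytᵀ) + δ • (D • (1 : Matrix (Fin d) (Fin d) _))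
  have nat : ∀ {B : Type} [CommRing B] [Algebra ℝ B] (Z : Matrix (Fin d) κ B),
      aeval (fun x : Fin d × κ => Z x.1 x.2) (D * Hf n f D N) = (Zᵀ * Z).det *
        Hf n f (Zᵀ * Z).det (ε • (Z * (Zᵀ * Z).adjugate * Zᵀ) +
          δ • ((Zᵀ * Z).det • (1 : Matrix (Fin d) (Fin d) B))) := by
    intro B _ _ Z
    obtain ⟨φ, hφ⟩ : ∃ φ : MvPolynomial (Fin d × κ) ℝ →ₐ[ℝ] B,
      φ = aeval (fun x : Fin d × κ => Z x.1 x.2) := ⟨_, rfl⟩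
    rw [← hφ]
    have hY : Yt.map φ = Z := by
      ext i a
      rw [Matrix.map_apply, hφ]
      simp [Yt]
    have hYt : Ytᵀ.map φ = Zᵀ := by rw [← hY]; rfl
    have hG : (Ytᵀ * Yt).map φ = Zᵀ * Z := by
      rw [Matrix.map_mul, hY, hYt]
    have hD : φ D = (Zᵀ * Z).det := by
      rw [← hG]; exact AlgHom.map_det φ _
    have hA : (Ytᵀ * Yt).adjugate.map φ = (Zᵀ * Z).adjugate := by
      rw [← hG]; exact AlgHom.map_adjugate φ _
    have hN : N.map φ = ε • (Z * (Zᵀ * Z).adjugate * Zᵀ) +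
          δ • ((Zᵀ * Z).det • (1 : Matrix (Fin d) (Fin d) B)) := by
      have e1 : (Yt * (Ytᵀ * Yt).adjugate * Ytᵀ).map φ = Z * (Zᵀ * Z).adjugate * Zᵀ := by
        rw [Matrix.map_mul, Matrix.map_mul, hY, hYt, hA]
      rw [← e1, ← hD]
      ext i j
      simp only [N, Matrix.map_apply, Matrix.add_apply, Matrix.smul_apply, map_add, map_smul,
        smul_eq_mul, map_mul, Matrix.one_apply, apply_ite φ, map_one, map_zero]
    rw [map_mul, Hf_map, hD, hN]
  have hzero : D * Hf n f D N = 0 := by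
    apply MvPolynomial.funext
    intro y
    obtain ⟨Z, hZ⟩ : ∃ Z : Matrix (Fin d) κ ℝ, ∀ i a, Z i a = y (i, a) := ⟨fun i a => y (i, a), fun _ _ => rfl⟩
    have := nat (B := ℝ) Z
    simp only [hZ] at this
    rw [aeval_eq_eval] at this
    rw [map_zero]
    refine Eq.trans this ?_
    by_cases h : (Zᵀ * Z).det = 0
    · rw [h, zero_mul]
    · have e : ε • (Z * (Zᵀ * Z).adjugate * Zᵀ) +
          δ • ((Zᵀ * Z).det • (1 : Matrix (Fin d) (Fin d) ℝ)) =
          (Zᵀ * Z).det • (ε • (Z * (Zᵀ * Z)⁻¹ * Zᵀ) + δ • (1 : Matrix _ _ ℝ)) := by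
        rw [Matrix.inv_def, Ring.inverse_eq_inv', Matrix.mul_smul, Matrix.smul_mul, smul_add,
          smul_comm _ ε, smul_comm _ δ, smul_smul _ _⁻¹, mul_inv_cancel₀ h, one_smul]
      rw [e, Hf_smul n f hn, hf _ (proj_mem Z h), mul_zero, mul_zero]
  have := nat Q
  rw [hzero, hQ] at this
  simp only [map_zero, det_one, adjugate_one, Matrix.mul_one, one_smul, one_mul, Hf_one n f hn]
    at this
  exact this.symm

lemma exists_left_inv (Y : Matrix (Fin d) κ ℂ) (h : ∀ c, Y *ᵥ c = 0 → c = 0) :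
    ∃ Z : Matrix κ (Fin d) ℂ, Z * Y = 1 := by
  have hk : LinearMap.ker (Matrix.toLin' Y) = ⊥ := by
    rw [LinearMap.ker_eq_bot']
    intro c hc
    exact h c (by simpa using hc)
  obtain ⟨g, hg⟩ := LinearMap.exists_leftInverse_of_injective _ hk
  refine ⟨LinearMap.toMatrix' g, ?_⟩
  have := congrArg LinearMap.toMatrix' hg
  rw [LinearMap.toMatrix'_comp, LinearMap.toMatrix'_toLin', LinearMap.toMatrix'_id] at this
  exact this

lemma degen (n : ℕ) (f : MvPolynomial (Fin d × Fin d) ℝ) (hn : f.totalDegree ≤ n) (ε δ : ℝ)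
    (hε : ε ≠ 0)
    (hf : ∀ P ∈ Grass d (Fintype.card κ), mev (ε • P + δ • (1 : Matrix _ _ ℝ)) f = 0)
    (Y : Matrix (Fin d) κ ℂ) (hY : Yᵀ * Y = 0) (hi : ∀ c, Y *ᵥ c = 0 → c = 0) :
    mev (Y * Yᵀ) (homogeneousComponent n f) = 0 := by
  obtain ⟨Z0, hZ0⟩ := exists_left_inv Y hi
  have hZ0' : Yᵀ * Z0ᵀ = 1 := by rw [← transpose_mul, hZ0, transpose_one]
  obtain ⟨Z, hZ1, hZ2⟩ : ∃ Z : Matrix (Fin d) κ ℂ, Yᵀ * Z = (1/2 : ℂ) • 1 ∧ Zᵀ * Z = 0 := by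
    refine ⟨(1/2 : ℂ) • Z0ᵀ - (1/4 : ℂ) • (Y * (Z0 * Z0ᵀ)), ?_, ?_⟩
    · rw [Matrix.mul_sub, Matrix.mul_smul, Matrix.mul_smul, hZ0', ← Matrix.mul_assoc, hY]
      simp
    · simp only [transpose_sub, transpose_smul, transpose_mul, transpose_transpose, Matrix.sub_mul,
        Matrix.mul_sub, Matrix.smul_mul, Matrix.mul_smul]
      have a1 : Z0 * Z0ᵀ * Yᵀ * Z0ᵀ = Z0 * Z0ᵀ := by rw [Matrix.mul_assoc, hZ0', Matrix.mul_one]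
      have a2 : Z0 * (Y * (Z0 * Z0ᵀ)) = Z0 * Z0ᵀ := by rw [← Matrix.mul_assoc, hZ0, Matrix.one_mul]
      have a3 : Z0 * Z0ᵀ * Yᵀ * (Y * (Z0 * Z0ᵀ)) = 0 := by
        rw [Matrix.mul_assoc, ← Matrix.mul_assoc Yᵀ, hY]; simp
      rw [a1, a2, a3]
      module
  have hZ1' : Zᵀ * Y = (1/2 : ℂ) • 1 := by
    have := congrArg transpose hZ1
    rwa [transpose_mul, transpose_transpose, transpose_smul, transpose_one] at this
  let N : Matrix (Fin d) (Fin d) (Polynomial ℂ) := fun i j =>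
    ε • (Polynomial.C ((Y * Yᵀ) i j) + Polynomial.X * Polynomial.C ((Y * Zᵀ + Z * Yᵀ) i j) +
      Polynomial.X ^ 2 * Polynomial.C ((Z * Zᵀ) i j)) +
      δ • (Polynomial.X * Polynomial.C ((1 : Matrix (Fin d) (Fin d) ℂ) i j))
  have nat : ∀ r : ℂ, Polynomial.eval r (Hf n f Polynomial.X N) = Hf n f r
      (ε • (Y * Yᵀ + r • (Y * Zᵀ + Z * Yᵀ) + r ^ 2 • (Z * Zᵀ)) + δ • (r • 1)) := by
    intro r
    have := Hf_map ((Polynomial.aeval (R := ℂ) r).restrictScalars ℝ) n f Polynomial.X N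
    simp only [AlgHom.restrictScalars_apply, Polynomial.aeval_X] at this
    rw [← Polynomial.coe_aeval_eq_eval]
    refine this.trans ?_
    congr 1
    ext i j
    rw [Matrix.map_apply]
    simp only [N, Matrix.add_apply, Matrix.smul_apply, map_add, map_smul,
      AlgHom.restrictScalars_apply, map_mul, map_pow, Polynomial.aeval_X, Polynomial.aeval_C,
      smul_eq_mul, Algebra.algebraMap_self, RingHom.id_apply]
  have hz : ∀ r : ℂ, r ≠ 0 → Polynomial.eval r (Hf n f Polynomial.X N) = 0 := by
    intro r hr
    obtain ⟨s, hs⟩ := IsAlgClosed.exists_pow_nat_eq r⁻¹ (n := 2) two_pos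
    have hs0 : s ≠ 0 := by
      rintro rfl
      apply inv_ne_zero hr
      rw [← hs]; simp
    have hrs : r = (s⁻¹) ^ 2 := by rw [inv_pow, hs, inv_inv]
    have hQ : (s • Y + s⁻¹ • Z)ᵀ * (s • Y + s⁻¹ • Z) = 1 := by
      simp only [transpose_add, transpose_smul, Matrix.add_mul, Matrix.mul_add, Matrix.smul_mul,
        Matrix.mul_smul, hY, hZ1, hZ1', hZ2, smul_smul, smul_zero, zero_add, add_zero,
        mul_inv_cancel₀ hs0, inv_mul_cancel₀ hs0, one_smul]
      rw [← add_smul]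
      have : s * (s⁻¹ * (1 / 2)) + s⁻¹ * (s * (1 / 2)) = 1 := by field_simp; norm_num
      rw [this, one_smul]
    have h1 := dens n f hn ε δ hf _ hQ
    have h2 := Hf_smul n f hn r
      (ε • ((s • Y + s⁻¹ • Z) * (s • Y + s⁻¹ • Z)ᵀ) + δ • (1 : Matrix _ _ ℂ))
    rw [h1, mul_zero] at h2
    rw [nat, ← h2]
    congr 1
    simp only [transpose_add, transpose_smul, Matrix.add_mul, Matrix.mul_add, Matrix.smul_mul,
        Matrix.mul_smul, smul_smul, smul_add, smul_comm r ε, smul_comm r δ,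
        mul_inv_cancel₀ hs0, inv_mul_cancel₀ hs0, one_smul]
    have c1 : r * (s * s) = 1 := by rw [hrs]; field_simp
    have c2 : r * (s⁻¹ * s⁻¹) = r ^ 2 := by rw [hrs]; ring
    rw [c1, c2, one_smul]
    abel_nf
  have hp : Hf n f Polynomial.X N = 0 := by
    have : Polynomial.X * Hf n f Polynomial.X N = 0 := by
      apply Polynomial.funext
      intro r
      rw [Polynomial.eval_mul]
      by_cases hr : r = 0
      · simp [hr]
      · simp [hz r hr]
    exact (mul_eq_zero.1 this).resolve_left Polynomial.X_ne_zero
  have h0 := nat 0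
  rw [hp, Hf_zero] at h0
  have e : ε • (Y * Yᵀ + (0:ℂ) • (Y * Zᵀ + Z * Yᵀ) + (0:ℂ) ^ 2 • (Z * Zᵀ)) +
      δ • ((0:ℂ) • (1 : Matrix (Fin d) (Fin d) ℂ)) = (ε : ℂ) • (Y * Yᵀ) := by
    simp
  rw [e, mev_smul_hom n _ (homogeneousComponent_isHomogeneous n f)] at h0
  simpa [hε] using h0
end Dens

section Fis
variable {d : ℕ}

/-- Symmetrised derivative. -/
noncomputable def DD (i j : Fin d) (h : MvPolynomial (Fin d × Fin d) ℝ) :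
    MvPolynomial (Fin d × Fin d) ℝ := pderiv (i, j) h + pderiv (j, i) h

/-- The condition that `F` drops degree on projectors. -/
def Drop (n : ℕ) (F : MvPolynomial (Fin d × Fin d) ℝ) : Prop :=
  ∃ b g : MvPolynomial (Fin d × Fin d) ℝ, b.totalDegree ≤ n - 1 ∧ g.totalDegree ≤ n - 1 ∧
    ∀ P : Matrix (Fin d) (Fin d) ℝ, P.IsSymm → P * P = P →
      mev P F = P.trace * mev P b + mev P g

/-- Vanishing on the null cone. -/
def Nul (F : MvPolynomial (Fin d × Fin d) ℝ) : Prop :=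
  ∀ M : Matrix (Fin d) (Fin d) ℂ, M.IsSymm → M * M = 0 → M.trace = 0 → mev M F = 0

/-- The space of polynomials to project away. -/
noncomputable def Jn (d n : ℕ) : Submodule ℝ (MvPolynomial (Fin d × Fin d) ℝ) where
  carrier := {F | F.IsHomogeneous n ∧ Drop n F ∧ Nul F}
  zero_mem' := by
    refine ⟨isHomogeneous_zero _ _ _, ⟨0, 0, by simp, by simp, ?_⟩, ?_⟩
    · intro P _ _; simp
    · intro P _ _ _; simp
  add_mem' := by
    rintro F G ⟨h1, ⟨b, g, h2, h3, h4⟩, h5⟩ ⟨k1, ⟨b', g', k2, k3, k4⟩, k5⟩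
    refine ⟨h1.add k1, ⟨b + b', g + g', (totalDegree_add _ _).trans (max_le h2 k2),
      (totalDegree_add _ _).trans (max_le h3 k3), ?_⟩, ?_⟩
    · intro P p1 p2
      rw [map_add, h4 P p1 p2, k4 P p1 p2, map_add, map_add]; ring
    · intro M p1 p2 p3
      rw [map_add, h5 M p1 p2 p3, k5 M p1 p2 p3, add_zero]
  smul_mem' := by
    rintro c F ⟨h1, ⟨b, g, h2, h3, h4⟩, h5⟩
    refine ⟨(homogeneousSubmodule _ _ n).smul_mem c h1, ⟨c • b, c • g,
      (totalDegree_smul_le _ _).trans h2, (totalDegree_smul_le _ _).trans h3, ?_⟩, ?_⟩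
    · intro P p1 p2
      rw [map_smul, h4 P p1 p2, map_smul, map_smul, smul_eq_mul, smul_eq_mul, smul_eq_mul]; ring
    · intro M p1 p2 p3
      rw [map_smul, h5 M p1 p2 p3, smul_zero]

lemma mem_Jn {n : ℕ} {F : MvPolynomial (Fin d × Fin d) ℝ} :
    F ∈ Jn d n ↔ F.IsHomogeneous n ∧ Drop n F ∧ Nul F := Iff.rfl

lemma tau_mem (n : ℕ) (a : MvPolynomial (Fin d × Fin d) ℝ) (ha : a.IsHomogeneous n) :
    (∑ i, X (i, i)) * a ∈ Jn d (n + 1) := by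
  refine ⟨?_, ⟨a, 0, ?_, by simp, ?_⟩, ?_⟩
  · rw [add_comm]
    exact (IsHomogeneous.sum _ _ _ fun i _ => isHomogeneous_X _ _).mul ha
  · simpa using ha.totalDegree_le
  · intro P _ _
    simp [mev_X, Matrix.trace]
  · intro M _ _ h
    have : ∑ i, M i i = 0 := h
    simp [mev_X, this]

lemma rho_mem (n : ℕ) (j k : Fin d) (a : MvPolynomial (Fin d × Fin d) ℝ) (ha : a.IsHomogeneous n) :
    (∑ i, (X (i, j) + X (j, i)) * (X (i, k) + X (k, i))) * a ∈ Jn d (n + 2) := by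
  have key : ∀ {A : Type} [CommRing A] [Algebra ℝ A] (M : Matrix (Fin d) (Fin d) A), M.IsSymm →
      mev M (∑ i, (X (i, j) + X (j, i)) * (X (i, k) + X (k, i))) = 4 * (M * M) j k := by
    intro A _ _ M hM
    have hs : ∀ i j, M i j = M j i := fun i j => hM.apply j i
    rw [map_sum, Matrix.mul_apply, Finset.mul_sum]
    refine Finset.sum_congr rfl fun i _ => ?_
    simp only [map_mul, map_add, mev_X]
    rw [hs i j, hs k i]; ring
  refine ⟨?_, ⟨0, 4 * X (j, k) * a, by simp, ?_, ?_⟩, ?_⟩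
  · rw [add_comm]
    refine (IsHomogeneous.sum _ _ _ fun i _ => ?_).mul ha
    exact ((isHomogeneous_X _ _).add (isHomogeneous_X _ _)).mul
      ((isHomogeneous_X _ _).add (isHomogeneous_X _ _))
  · have : (4 * X (j, k) * a : MvPolynomial (Fin d × Fin d) ℝ) = (4:ℝ) • (X (j, k) * a) := by
      rw [smul_eq_C_mul, mul_assoc]; rfl
    rw [this]
    refine (totalDegree_smul_le _ _).trans ?_
    refine ((isHomogeneous_X ℝ (j, k)).mul ha).totalDegree_le.trans ?_
    omega
  · intro P h1 h2
    have h4 : mev P 4 = 4 := map_ofNat (mev P) 4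
    rw [map_mul, key P h1, h2]
    simp [mev_X, h4]
  · intro M h1 h2 _
    rw [map_mul, key M h1, h2]
    simp

theorem fischer (n : ℕ) (F : MvPolynomial (Fin d × Fin d) ℝ) (hF : F.IsHomogeneous (n + 1)) :
    ∃ j h : MvPolynomial (Fin d × Fin d) ℝ, F = j + h ∧ h.IsHomogeneous (n + 1) ∧
      Drop (n + 1) j ∧ Nul j ∧ ∑ i, pderiv (i, i) h = 0 ∧
      ∀ j k, ∑ i, DD i j (DD i k h) = 0 := by
  have hfin : FiniteDimensional ℝ (Jn d (n + 1)) := by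
    refine Submodule.finiteDimensional_of_le
      (S₂ := restrictTotalDegree (Fin d × Fin d) ℝ (n + 1)) ?_
    intro F hF
    rw [mem_restrictTotalDegree]
    exact hF.1.totalDegree_le
  let φ : Jn d (n+1) →ₗ[ℝ] Module.Dual ℝ (Jn d (n+1)) :=
    ((Submodule.subtype (Jn d (n+1))).dualMap.comp fis).comp (Submodule.subtype (Jn d (n+1)))
  have hφ : Function.Injective φ := by
    rw [injective_iff_map_eq_zero]
    intro x hx
    exact Subtype.ext (fis_self_eq_zero _ (LinearMap.congr_fun hx x))
  have hs : Function.Surjective φ :=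
    (LinearMap.injective_iff_surjective_of_finrank_eq_finrank
      (Subspace.dual_finrank_eq (K := ℝ) (V := Jn d (n+1))).symm).1 hφ
  obtain ⟨⟨j, hj⟩, hj'⟩ := hs ((Submodule.subtype (Jn d (n+1))).dualMap (fis F))
  obtain ⟨h, hsum⟩ : ∃ h, j + h = F := ⟨F - j, by ring⟩
  have horth : ∀ q ∈ Jn d (n+1), fis q h = 0 := by
    intro q hq
    have h1 : fis j q = fis F q := LinearMap.congr_fun hj' ⟨q, hq⟩
    rw [← hsum, map_add, LinearMap.add_apply] at h1
    rw [fis_comm]; linarith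
  have hhom : h.IsHomogeneous (n + 1) := by
    have : h = F - j := by rw [← hsum]; ring
    rw [this]
    exact hF.sub hj.1
  refine ⟨j, h, hsum.symm, hhom, hj.2.1, hj.2.2, ?_, ?_⟩
  · apply fis_self_eq_zero
    have h1 : (∑ i, pderiv (i, i) h).IsHomogeneous n :=
      IsHomogeneous.sum _ _ _ fun i _ => by simpa using hhom.pderiv
    have h2 := horth _ (tau_mem n _ h1)
    rw [Finset.sum_mul, map_sum, LinearMap.sum_apply] at h2
    simp only [fis_X_mul] at h2
    rwa [← map_sum] at h2
  · intro j k
    have hD : ∀ {m : ℕ} {q : MvPolynomial (Fin d × Fin d) ℝ} (i j : Fin d),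
        q.IsHomogeneous (m + 1) → (DD i j q).IsHomogeneous m := by
      intro m q i j hq
      refine IsHomogeneous.add ?_ ?_
      · simpa using hq.pderiv
      · simpa using hq.pderiv
    cases n with
    | zero =>
      refine Finset.sum_eq_zero fun i _ => ?_
      have h1 := hD i k hhom
      have h2 : (DD i k h).totalDegree = 0 := Nat.le_zero.1 h1.totalDegree_le
      rw [totalDegree_eq_zero_iff_eq_C] at h2
      rw [h2]
      simp [DD]
    | succ n =>
      apply fis_self_eq_zero
      have h1 : (∑ i, DD i j (DD i k h)).IsHomogeneous n :=
        IsHomogeneous.sum _ _ _ fun i _ => hD _ _ (hD _ _ hhom)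
      have h2 := horth _ (rho_mem n j k _ h1)
      have h3 : ∀ (i k : Fin d) (a g : MvPolynomial (Fin d × Fin d) ℝ),
          fis ((X (i, k) + X (k, i)) * a) g = fis a (DD i k g) := by
        intro i k a g
        rw [add_mul, map_add, LinearMap.add_apply, fis_X_mul, fis_X_mul, ← map_add, DD]
      have h4 : ∀ (i j : Fin d) (q : MvPolynomial (Fin d × Fin d) ℝ),
          DD i k (DD i j q) = DD i j (DD i k q) := by
        intro i j q
        simp only [DD, map_add]
        rw [pderiv_comm' (i, k) (i, j), pderiv_comm' (i, k) (j, i), pderiv_comm' (k, i) (i, j),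
          pderiv_comm' (k, i) (j, i)]
        ring
      rw [Finset.sum_mul, map_sum, LinearMap.sum_apply] at h2
      simp only [mul_assoc, h3] at h2
      rw [← map_sum] at h2
      simpa only [h4] using h2
end Fis

section Pull
variable {d : ℕ} {ι κ : Type} [Fintype ι] [DecidableEq ι] [Fintype κ] [DecidableEq κ]

/-- Generic isotropic frame in adapted coordinates. -/
noncomputable def Yt (κ : Type) (T : Fin d → ι → ℂ) : Matrix (Fin d) κ (MvPolynomial (ι × κ) ℂ) :=
  fun j a => ∑ i, C (T j i) * X (i, a)

lemma pderiv_Yt (T : Fin d → ι → ℂ) (i : ι) (a b : κ) (j : Fin d) :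
    pderiv (i, a) (Yt κ T j b) = if a = b then C (T j i) else 0 := by
  unfold Yt
  simp only [map_sum, Derivation.leibniz, pderiv_C, pderiv_X, smul_eq_mul, mul_zero, add_zero,
    Pi.single_apply, Prod.mk.injEq]
  by_cases h : a = b
  · subst h; simp
  · have h' : ¬ b = a := fun h' => h h'.symm
    simp [h, h']

lemma deriv_mev {A : Type} [CommRing A] [Algebra ℝ A] (D : Derivation ℝ A A)
    (Y : Matrix (Fin d) κ A) (a : κ) (c : Fin d → A)
    (hD : ∀ j b, D (Y j b) = if a = b then c j else 0) (q : MvPolynomial (Fin d × Fin d) ℝ) :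
    D (mev (Y * Yᵀ) q) = ∑ j, ∑ k, mev (Y * Yᵀ) (DD j k q) * (c j * Y k a) := by
  have h : D (mev (Y * Yᵀ) q) =
      ∑ x : Fin d × Fin d, mev (Y * Yᵀ) (pderiv x q) * D ((Y * Yᵀ) x.1 x.2) :=
    chain_aeval (R := ℝ) D (fun x : Fin d × Fin d => (Y * Yᵀ) x.1 x.2) q
  have h1 : ∀ j k, D ((Y * Yᵀ) j k) = c j * Y k a + c k * Y j a := by
    intro j k
    rw [Matrix.mul_apply, map_sum]
    simp only [Matrix.transpose_apply, Derivation.leibniz, hD, smul_eq_mul, mul_ite,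
      mul_zero, Finset.sum_add_distrib, Finset.sum_ite_eq, Finset.mem_univ, if_true]
    ring
  rw [h, Fintype.sum_prod_type]
  simp only [h1]
  simp only [DD, map_add, add_mul, mul_add, Finset.sum_add_distrib]
  refine congrArg₂ (· + ·) rfl ?_
  rw [Finset.sum_comm]

lemma deriv_PH {A : Type} [CommRing A] [Algebra ℝ A] (D : ι → κ → Derivation ℝ A A)
    (Y : Matrix (Fin d) κ A) (T : Fin d → ι → A)
    (hD : ∀ i a j b, D i a (Y j b) = if a = b then T j i else 0)
    (hDT : ∀ i a j i', D i a (T j i') = 0) (σ : ι → ι)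
    (hTC : ∀ j k, ∑ i, T j i * T k (σ i) = if j = k then 1 else 0)
    (h : MvPolynomial (Fin d × Fin d) ℝ) (h1 : ∑ i, pderiv (i, i) h = 0)
    (h2 : ∀ j k, ∑ i, DD i j (DD i k h) = 0) (a b : κ) :
    ∑ i, D i a (D (σ i) b (mev (Y * Yᵀ) h)) = 0 := by
  have key : ∀ i a q, D i a (mev (Y * Yᵀ) q) =
      ∑ j, ∑ k, mev (Y * Yᵀ) (DD j k q) * (T j i * Y k a) :=
    fun i a q => deriv_mev (D i a) Y a (fun j => T j i) (fun j b => hD i a j b) q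
  generalize Y * Yᵀ = M at *
  have e1 : ∀ i, D i a (D (σ i) b (mev M h)) =
      ∑ j, ∑ k, (mev M (DD j k h) * (if a = b then 1 else 0)) * (T k i * T j (σ i)) +
      ∑ j, ∑ k, ∑ l, ∑ m, (mev M (DD l m (DD j k h)) * Y m a * Y k b) *
        (T l i * T j (σ i)) := by
    intro i
    rw [key]
    simp only [map_sum, ← Finset.sum_add_distrib]
    refine Finset.sum_congr rfl fun j _ => Finset.sum_congr rfl fun k _ => ?_
    rw [Derivation.leibniz, Derivation.leibniz, hDT, key, hD]
    simp only [smul_eq_mul, mul_zero, add_zero, Finset.mul_sum]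
    congr 1
    · split_ifs
      · ring
      · ring
    · refine Finset.sum_congr rfl fun l _ => Finset.sum_congr rfl fun m _ => ?_
      ring
  simp only [e1, Finset.sum_add_distrib]
  have s1 : ∑ i, ∑ j, ∑ k, (mev M (DD j k h) * (if a = b then 1 else 0)) *
      (T k i * T j (σ i)) = 0 := by
    rw [Finset.sum_comm]
    have : ∀ j, ∑ i, ∑ k, (mev M (DD j k h) * (if a = b then 1 else 0)) *
      (T k i * T j (σ i)) = mev M (DD j j h) * (if a = b then 1 else 0) := by
      intro j
      rw [Finset.sum_comm]
      simp only [← Finset.mul_sum, hTC]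
      simp
    refine (Finset.sum_congr rfl fun j _ => this j).trans ?_
    have e0 : ∑ j, DD j j h = 0 := by
      simp only [DD, Finset.sum_add_distrib, h1, add_zero]
    rw [← Finset.sum_mul, ← map_sum, e0, map_zero, zero_mul]
  have s2 : ∑ i, ∑ j, ∑ k, ∑ l, ∑ m, (mev M (DD l m (DD j k h)) * Y m a * Y k b) *
        (T l i * T j (σ i)) = 0 := by
    have : ∀ j k, ∑ i, ∑ l, ∑ m, (mev M (DD l m (DD j k h)) * Y m a * Y k b) *
        (T l i * T j (σ i)) = ∑ m, mev M (DD j m (DD j k h)) * Y m a * Y k b := by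
      intro j k
      rw [Finset.sum_comm]
      have : ∀ l, ∑ i, ∑ m, (mev M (DD l m (DD j k h)) * Y m a * Y k b) *
        (T l i * T j (σ i)) =
          (∑ m, (mev M (DD l m (DD j k h)) * Y m a * Y k b)) * if l = j then 1 else 0 := by
        intro l
        simp only [← Finset.sum_mul, ← Finset.mul_sum, hTC]
      simp only [this]
      simp
    rw [Finset.sum_comm]
    have e2 : ∀ j, ∑ i, ∑ k, ∑ l, ∑ m, (mev M (DD l m (DD j k h)) * Y m a * Y k b) *
        (T l i * T j (σ i)) = ∑ k, ∑ m, mev M (DD j m (DD j k h)) * Y m a * Y k b := by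
      intro j
      rw [Finset.sum_comm]
      exact Finset.sum_congr rfl fun k _ => this j k
    simp only [e2]
    rw [Finset.sum_comm]
    refine Finset.sum_eq_zero fun k _ => ?_
    rw [Finset.sum_comm]
    refine Finset.sum_eq_zero fun m _ => ?_
    rw [← Finset.sum_mul, ← Finset.sum_mul, ← map_sum, h2]
    simp
  rw [s1, s2, add_zero]

lemma pull_PH (σ : ι → ι) (T : Fin d → ι → ℂ)
    (hT : ∀ j k, ∑ i, T j i * T k (σ i) = if j = k then 1 else 0)
    (h : MvPolynomial (Fin d × Fin d) ℝ) (h1 : ∑ i, pderiv (i, i) h = 0)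
    (h2 : ∀ j k, ∑ i, DD i j (DD i k h) = 0) :
    PH σ (mev (Yt κ T * (Yt κ T)ᵀ) h) := by
  intro a b
  have hTC : ∀ j k, ∑ i, (C (T j i) * C (T k (σ i)) : MvPolynomial (ι × κ) ℂ)
      = if j = k then 1 else 0 := by
    intro j k
    simp only [← C_mul, ← map_sum, hT]
    split_ifs <;> simp
  exact deriv_PH (fun i a => Derivation.restrictScalars ℝ (pderiv (R := ℂ) (i, a))) (Yt κ T)
    (fun j i => C (T j i)) (fun i a j b => pderiv_Yt T i a b j) (fun i a j i' => pderiv_C) σ hTC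
    h h1 h2 a b

end Pull

section LemH
variable {d : ℕ}

/-- Harmonic polynomials vanishing on the isotropic frames vanish on all low-rank Gram matrices. -/
lemma harmonic_gram (m : ℕ) (hm : 2 * m ≤ d) (h : MvPolynomial (Fin d × Fin d) ℝ)
    (h1 : ∑ i, pderiv (i, i) h = 0) (h2 : ∀ j k, ∑ i, DD i j (DD i k h) = 0)
    (hv : ∀ (κ : Type) [Fintype κ] [DecidableEq κ], Fintype.card κ = m →
      ∀ Y : Matrix (Fin d) κ ℂ, Yᵀ * Y = 0 → (∀ c, Y *ᵥ c = 0 → c = 0) → mev (Y * Yᵀ) h = 0) :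
    ∃ (κ : Type) (_ : Fintype κ) (_ : DecidableEq κ), Fintype.card κ = m ∧
      ∀ Y : Matrix (Fin d) κ ℝ, mev (Y * Yᵀ) h = 0 := by
  obtain ⟨ι, κ, _, _, _, _, σ, T0, hσ, hι, hκ, hL, hT0⟩ := exists_LemC (d - 2 * m) m
  refine ⟨κ, inferInstance, inferInstance, hκ, ?_⟩
  have hc : Fintype.card (Fin d) = Fintype.card ι := by rw [hι, Fintype.card_fin]; omega
  let e : Fin d ≃ ι := Fintype.equivOfCardEq hc
  obtain ⟨T, hTdef⟩ : ∃ T : Fin d → ι → ℂ, T = fun j i => T0 (e j) i := ⟨_, rfl⟩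
  have hT1 : ∀ j k, ∑ i, T j i * T k (σ i) = if j = k then 1 else 0 := by
    intro j k; rw [hTdef]; simp [hT0]
  -- the reversed relation
  have hT2 : ∀ i k, ∑ j, T j (σ i) * T j k = if i = k then 1 else 0 := by
    have m1 : (Matrix.of T0) * (Matrix.of fun i k => T0 k (σ i)) = (1 : Matrix ι ι ℂ) := by
      ext j k
      simp [Matrix.mul_apply, hT0, Matrix.one_apply]
    have m2 := _root_.mul_eq_one_comm.1 m1
    intro i k
    have := congrFun (congrFun m2 i) k
    simp only [Matrix.mul_apply, Matrix.of_apply, Matrix.one_apply] at this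
    rw [← this, hTdef]
    exact Equiv.sum_comp e (fun l => T0 l (σ i) * T0 l k)
  have hev : ∀ Z : ι → κ → ℂ, eval (fun x => Z x.1 x.2) (mev (Yt κ T * (Yt κ T)ᵀ) h) =
      mev ((Matrix.of T * Matrix.of Z) * (Matrix.of T * Matrix.of Z)ᵀ) h := by
    intro Z
    have := mev_map ((aeval (R := ℂ) (fun x : ι × κ => Z x.1 x.2)).restrictScalars ℝ)
      (Yt κ T * (Yt κ T)ᵀ) h
    simp only [AlgHom.restrictScalars_apply] at this
    have e0 : eval (fun x : ι × κ => Z x.1 x.2) (mev (Yt κ T * (Yt κ T)ᵀ) h) =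
      aeval (R := ℂ) (fun x : ι × κ => Z x.1 x.2) (mev (Yt κ T * (Yt κ T)ᵀ) h) := by
      rw [aeval_eq_eval]
    rw [e0, this]
    congr 2
    ext j k
    rw [Matrix.map_apply]
    simp only [Matrix.mul_apply, Yt, Matrix.transpose_apply, map_sum, map_mul,
      AlgHom.restrictScalars_apply, aeval_X, Matrix.of_apply]
    simp
  have hp : mev (Yt κ T * (Yt κ T)ᵀ) h = 0 := by
    refine hL _ (pull_PH σ T hT1 h h1 h2) ?_
    intro Z hZ
    rw [hev]
    refine hv κ hκ _ ?_ ?_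
    · ext a b
      have := hZ.1 a b
      rw [Matrix.transpose_mul, Matrix.mul_assoc, ← Matrix.mul_assoc (Matrix.of T)ᵀ]
      have e1 : (Matrix.of T)ᵀ * Matrix.of T = Matrix.of fun i k => if σ i = k then (1:ℂ) else 0 := by
        ext i k
        have := hT2 (σ i) k
        rw [hσ] at this
        simpa [Matrix.mul_apply] using this
      rw [e1]
      simpa [Matrix.mul_apply] using this
    · intro c hc
      apply hZ.2 c
      have e1 : (Matrix.of fun i j => T j (σ i)) * Matrix.of T = (1 : Matrix ι ι ℂ) := by
        ext i k
        simpa [Matrix.mul_apply, Matrix.one_apply] using hT2 i k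
      have e2 : (Matrix.of Z) *ᵥ c = 0 := by
        rw [← Matrix.mulVec_mulVec] at hc
        have := congrArg (fun v => (Matrix.of fun i j => T j (σ i)) *ᵥ v) hc
        simpa [Matrix.mulVec_mulVec, ← Matrix.mul_assoc, e1] using this
      intro i
      exact congrFun e2 i
  intro Y
  have e3 := hev (fun i a => ∑ j, T j (σ i) * (Y j a : ℂ))
  rw [hp, map_zero] at e3
  have e4 : Matrix.of T * Matrix.of (fun i a => ∑ j, T j (σ i) * (Y j a : ℂ)) =
      Y.map (Complex.ofRealHom) := by
    have e1 : Matrix.of T * (Matrix.of fun i j => T j (σ i))  = (1 : Matrix _ _ ℂ) := by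
      ext i k
      simpa [Matrix.mul_apply, Matrix.one_apply] using hT1 i k
    have e5 : Matrix.of (fun i a => ∑ j, T j (σ i) * (Y j a : ℂ)) =
      (Matrix.of fun i j => T j (σ i)) * Y.map (Complex.ofRealHom) := by
      ext i a; simp [Matrix.mul_apply]
    rw [e5, ← Matrix.mul_assoc, e1, Matrix.one_mul]
  rw [e4] at e3
  have e6 := mev_map (Algebra.ofId ℝ ℂ) (Y * Yᵀ) h
  have e7 : (Y * Yᵀ).map (Algebra.ofId ℝ ℂ) =
      Y.map Complex.ofRealHom * (Y.map Complex.ofRealHom)ᵀ := by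
    ext i j
    rw [Matrix.map_apply]
    simp [Matrix.mul_apply, Algebra.ofId_apply]
  rw [e7, ← e3] at e6
  have : ((mev (Y * Yᵀ) h : ℝ) : ℂ) = 0 := e6
  exact_mod_cast this

/-- Low-rank projectors are Gram matrices. -/
lemma proj_gram {κ : Type} [Fintype κ] [DecidableEq κ] (l : ℕ) (hl : l ≤ Fintype.card κ)
    (P : Matrix (Fin d) (Fin d) ℝ) (hP : P ∈ Grass d l) : ∃ Y : Matrix (Fin d) κ ℝ, P = Y * Yᵀ := by
  classical
  obtain ⟨p1, p2, p3⟩ := hP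
  have hA : P.IsHermitian := by rw [Matrix.IsHermitian, Matrix.conjTranspose_eq_transpose_of_trivial]; exact p1
  have hev : ∀ i, hA.eigenvalues i = 0 ∨ hA.eigenvalues i = 1 := by
    intro i
    have q1 := hA.mulVec_eigenvectorBasis i
    have hne : (hA.eigenvectorBasis i).ofLp ≠ 0 := by
      intro h0
      have := hA.eigenvectorBasis.orthonormal.ne_zero i
      exact this (by ext x; simp [h0])
    have q2 : P *ᵥ (P *ᵥ (hA.eigenvectorBasis i).ofLp) = P *ᵥ (hA.eigenvectorBasis i).ofLp := by
      rw [Matrix.mulVec_mulVec, p2]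
    rw [q1, Matrix.mulVec_smul, q1, smul_smul] at q2
    have q3 := smul_left_injective ℝ hne q2
    have : hA.eigenvalues i * (hA.eigenvalues i - 1) = 0 := by
      have q4 : hA.eigenvalues i * hA.eigenvalues i = hA.eigenvalues i := q3
      rw [mul_sub, q4, mul_one, sub_self]
    rcases mul_eq_zero.1 this with h | h
    · exact Or.inl h
    · exact Or.inr (by linarith)
  obtain ⟨s, hs⟩ : ∃ s : Finset (Fin d), s = Finset.univ.filter fun i => hA.eigenvalues i = 1 :=
    ⟨_, rfl⟩
  have hl1 : ∀ i, hA.eigenvalues i = if i ∈ s then 1 else 0 := by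
    intro i
    rcases hev i with h | h <;> simp [hs, h]
  have hcard : s.card = l := by
    have := hA.trace_eq_sum_eigenvalues
    rw [p3] at this
    simp only [hl1] at this
    simp at this
    exact_mod_cast this.symm
  have hemb : Nonempty (s ↪ κ) := by
    apply Function.Embedding.nonempty_of_card_le
    simpa [hcard] using hl
  obtain ⟨f⟩ := hemb
  let E : Matrix (Fin d) κ ℝ := fun i a => if h : i ∈ s then (if f ⟨i, h⟩ = a then 1 else 0) else 0
  have hE : Matrix.diagonal (fun i => hA.eigenvalues i) = E * Eᵀ := by
    ext i j
    rw [Matrix.mul_apply, Matrix.diagonal_apply, hl1]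
    simp only [Matrix.transpose_apply]
    simp only [E]
    by_cases hi : i ∈ s
    · by_cases hj : j ∈ s
      · simp only [hi, hj, dif_pos, if_true, ite_mul, one_mul, zero_mul]
        rw [Finset.sum_ite_eq]
        simp only [Finset.mem_univ, if_true, f.injective.eq_iff, Subtype.mk.injEq]
        simp only [eq_comm]
      · have : i ≠ j := fun h => hj (h ▸ hi)
        simp [hj, this]
    · simp [hi]
  refine ⟨(hA.eigenvectorUnitary : Matrix (Fin d) (Fin d) ℝ) * E, ?_⟩
  have hsp := hA.spectral_theorem
  rw [Unitary.conjStarAlgAut_apply] at hsp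
  rw [Matrix.transpose_mul, Matrix.mul_assoc, ← Matrix.mul_assoc E, ← hE, ← Matrix.mul_assoc]
  exact hsp

/-- Lemma H. -/
theorem lemH (n m : ℕ) (hm : 2 * m ≤ d) (h : MvPolynomial (Fin d × Fin d) ℝ)
    (hh : h.IsHomogeneous n)
    (h1 : ∑ i, pderiv (i, i) h = 0) (h2 : ∀ j k, ∑ i, DD i j (DD i k h) = 0)
    (hv : ∀ (κ : Type) [Fintype κ] [DecidableEq κ], Fintype.card κ = m →
      ∀ Y : Matrix (Fin d) κ ℂ, Yᵀ * Y = 0 → (∀ c, Y *ᵥ c = 0 → c = 0) → mev (Y * Yᵀ) h = 0)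
    (l : ℕ) (hld : l ≤ d) (hlm : min l (d - l) ≤ m) (P : Matrix (Fin d) (Fin d) ℝ)
    (hP : P ∈ Grass d l) : mev P h = 0 := by
  obtain ⟨κ, _, _, hκ, hY⟩ := harmonic_gram m hm h h1 h2 hv
  rcases min_le_iff.1 hlm with hl | hl
  · obtain ⟨Y, rfl⟩ := proj_gram (κ := κ) l (hκ ▸ hl) P hP
    exact hY Y
  · have hQ : 1 - P ∈ Grass d (d - l) := by
      obtain ⟨p1, p2, p3⟩ := hP
      refine ⟨?_, ?_, ?_⟩
      · rw [Matrix.IsSymm, Matrix.transpose_sub, Matrix.transpose_one, p1]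
      · rw [Matrix.sub_mul, Matrix.mul_sub, Matrix.mul_sub, p2]; simp
      · rw [Matrix.trace_sub, p3, Matrix.trace_one, Nat.cast_sub hld]; simp
    obtain ⟨Y, hYP⟩ := proj_gram (κ := κ) (d - l) (hκ ▸ hl) (1 - P) hQ
    have e1 : mev (1 - P) h = 0 := by rw [hYP]; exact hY Y
    have e2 := eval_line h (fun x : Fin d × Fin d => (-P) x.1 x.2)
      (fun x => (1 : Matrix (Fin d) (Fin d) ℝ) x.1 x.2) (by
        intro s
        rw [Fintype.sum_prod_type]
        have : ∀ y : Fin d × Fin d → ℝ, ∑ i, ∑ j, eval y (pderiv (i, j) h) *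
            (1 : Matrix (Fin d) (Fin d) ℝ) i j = 0 := by
          intro y
          have := congrArg (eval y) h1
          rw [map_sum, map_zero] at this
          simpa [Matrix.one_apply] using this
        exact this _)
    have e3 : eval (fun x : Fin d × Fin d => (-P) x.1 x.2 + (1 : Matrix (Fin d) (Fin d) ℝ) x.1 x.2) h
        = mev (1 - P) h := by
      rw [← eval_eq_mev]
      congr 2
      ext x
      simp only [Matrix.neg_apply, Matrix.sub_apply]; ring
    rw [e3, e1, eval_eq_mev] at e2
    have e4 := mev_smul_hom n h hh (-1 : ℝ) P
    rw [neg_one_smul, ← e2] at e4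
    exact (mul_eq_zero.1 e4.symm).resolve_left (pow_ne_zero _ (by norm_num))

end LemH

section Key
variable {d : ℕ}

lemma one_sub_mem (l : ℕ) (hld : l ≤ d) (P : Matrix (Fin d) (Fin d) ℝ) (hP : P ∈ Grass d l) :
    1 - P ∈ Grass d (d - l) := by
  obtain ⟨p1, p2, p3⟩ := hP
  refine ⟨?_, ?_, ?_⟩
  · rw [Matrix.IsSymm, Matrix.transpose_sub, Matrix.transpose_one, p1]
  · rw [Matrix.sub_mul, Matrix.mul_sub, Matrix.mul_sub, p2]; simp
  · rw [Matrix.trace_sub, p3, Matrix.trace_one, Nat.cast_sub hld]; simp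

lemma grass_nonempty (k : ℕ) (hk : k ≤ d) : (Grass d k).Nonempty := by
  refine ⟨Matrix.diagonal fun i => if (i : ℕ) < k then 1 else 0, ?_, ?_, ?_⟩
  · exact Matrix.diagonal_transpose _
  · rw [Matrix.diagonal_mul_diagonal]
    congr 1
    ext i
    split_ifs <;> simp
  · rw [Matrix.trace_diagonal, Fin.sum_univ_eq_sum_range (fun i => if i < k then (1 : ℝ) else 0)]
    rw [← Finset.sum_filter]
    have : (Finset.range d).filter (fun i => i < k) = Finset.range k := by
      ext i; simp; omega
    rw [this]; simp

theorem key_div (k : ℕ) (hk : k ≤ d) (t : ℕ) : ∀ f : MvPolynomial (Fin d × Fin d) ℝ,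
    f.totalDegree ≤ t → (∀ P ∈ Grass d k, mev P f = 0) →
    ∃ g : MvPolynomial (Fin d × Fin d) ℝ, (t = 0 → g = 0) ∧ g.totalDegree ≤ t - 1 ∧
      ∀ l ≤ d, min l (d - l) ≤ min k (d - k) → ∀ P ∈ Grass d l,
        mev P f = (P.trace - k) * mev P g := by
  induction t with
  | zero =>
    intro f hf hv
    refine ⟨0, fun _ => rfl, by simp, ?_⟩
    intro l _ _ P _
    obtain ⟨Q, hQ⟩ := grass_nonempty k hk
    have h0 := hv Q hQ
    rw [totalDegree_eq_zero_iff_eq_C.1 (Nat.le_zero.1 hf)] at h0 ⊢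
    simp only [mev, algHom_C] at h0 ⊢
    rw [h0]; simp
  | succ t ih =>
    intro f hf hv
    obtain ⟨j, h, hfj, hh, ⟨b, g0, hb, hg0, hj⟩, hnul, h1, h2⟩ :=
      fischer t (homogeneousComponent (t + 1) f) (homogeneousComponent_isHomogeneous (t + 1) f)
    have hvan : ∀ (κ : Type) [Fintype κ] [DecidableEq κ], Fintype.card κ = min k (d - k) →
      ∀ Y : Matrix (Fin d) κ ℂ, Yᵀ * Y = 0 → (∀ c, Y *ᵥ c = 0 → c = 0) →
        mev (Y * Yᵀ) h = 0 := by
      intro κ _ _ hκ Y hY hi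
      have a1 : mev (Y * Yᵀ) (homogeneousComponent (t + 1) f) = 0 := by
        rcases le_total k (d - k) with hc | hc
        · rw [min_eq_left hc] at hκ
          refine degen (t + 1) f hf 1 0 one_ne_zero ?_ Y hY hi
          intro P hP
          rw [hκ] at hP
          simpa using hv P hP
        · rw [min_eq_right hc] at hκ
          refine degen (t + 1) f hf (-1) 1 (by norm_num) ?_ Y hY hi
          intro P hP
          rw [hκ] at hP
          have := one_sub_mem (d - k) (by omega) P hP
          rw [Nat.sub_sub_self hk] at this
          have e : (-1 : ℝ) • P + (1 : ℝ) • (1 : Matrix (Fin d) (Fin d) ℝ) = 1 - P := by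
            rw [neg_one_smul, one_smul]; abel
          rw [e]
          exact hv _ this
      have a2 : mev (Y * Yᵀ) j = 0 := by
        apply hnul
        · rw [Matrix.IsSymm, Matrix.transpose_mul, Matrix.transpose_transpose]
        · rw [Matrix.mul_assoc, ← Matrix.mul_assoc Yᵀ, hY]; simp
        · rw [Matrix.trace_mul_comm, hY]; simp
      rw [hfj, map_add, a2, zero_add] at a1
      exact a1
    have hH := lemH (t + 1) (min k (d - k)) (by omega) h hh h1 h2 hvan
    have hlow : (f - homogeneousComponent (t + 1) f).totalDegree ≤ t := by
      have e : f - homogeneousComponent (t + 1) f =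
          ∑ e ∈ Finset.range (t + 1), homogeneousComponent e f := by
        have h : f = ∑ e ∈ Finset.range (t + 1 + 1), homogeneousComponent e f := by
          conv_lhs => rw [← sum_homogeneousComponent f]
          refine Finset.sum_subset (fun e he => ?_) (fun e _ he => ?_)
          · simp at he ⊢; omega
          · apply homogeneousComponent_eq_zero
            simp at he; omega
        rw [Finset.sum_range_succ] at h
        exact sub_eq_of_eq_add h
      rw [e]
      refine (totalDegree_finset_sum _ _).trans (Finset.sup_le fun e he => ?_)
      have := (homogeneousComponent_isHomogeneous e f).totalDegree_le
      simp at he; omega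
    obtain ⟨f', hf'⟩ : ∃ f', f' = (f - homogeneousComponent (t + 1) f) + (g0 + (k : ℝ) • b) :=
      ⟨_, rfl⟩
    have hdeg : f'.totalDegree ≤ t := by
      rw [hf']
      refine (totalDegree_add _ _).trans (max_le hlow ?_)
      refine (totalDegree_add _ _).trans (max_le hg0 ?_)
      exact (totalDegree_smul_le _ _).trans hb
    have hrel : ∀ l ≤ d, min l (d - l) ≤ min k (d - k) → ∀ P ∈ Grass d l,
        mev P f = mev P f' + (P.trace - k) * mev P b := by
      intro l hl hlm P hP
      have e1 := hH l hl hlm P hP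
      have e2 := hj P hP.1 hP.2.1
      have e3 := congrArg (mev P) hfj
      rw [hf', map_add, map_sub, map_add, map_smul, e3, map_add, e1, e2, smul_eq_mul]
      ring
    obtain ⟨g, _, hg1, hg2⟩ := ih f' hdeg (by
      intro P hP
      have := hrel k hk le_rfl P hP
      rw [hv P hP, hP.2.2, sub_self, zero_mul, add_zero] at this
      exact this.symm)
    refine ⟨b + g, by simp, ?_, ?_⟩
    · refine (totalDegree_add _ _).trans (max_le hb (hg1.trans (by omega)))
    · intro l hl hlm P hP
      rw [hrel l hl hlm P hP, hg2 l hl hlm P hP, map_add]; ring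

end Key

section Dim
variable {d : ℕ}

lemma mem_PolOn {t : ℕ} {S : Set (Matrix (Fin d) (Fin d) ℝ)} {φ : S → ℝ} :
    φ ∈ PolOn t S ↔ ∃ f : MvPolynomial (Fin d × Fin d) ℝ, f.totalDegree ≤ t ∧
      ∀ P : S, φ P = mev P.1 f := by
  constructor
  · rintro ⟨f, hf, rfl⟩
    exact ⟨f, (mem_restrictTotalDegree _ _ _).1 hf, fun P => eval_eq_mev _ _⟩
  · rintro ⟨f, hf, h⟩
    refine ⟨f, (mem_restrictTotalDegree _ _ _).2 hf, ?_⟩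
    funext P
    rw [h P, ← eval_eq_mev]
    rfl

instance (t : ℕ) (S : Set (Matrix (Fin d) (Fin d) ℝ)) : Module.Finite ℝ (PolOn t S) := by
  unfold PolOn
  infer_instance

open Classical in
/-- Multiplication by `tr - c`, extended by zero. -/
noncomputable def theta (S' S : Set (Matrix (Fin d) (Fin d) ℝ)) (c : ℝ) : (S' → ℝ) →ₗ[ℝ] (S → ℝ) where
  toFun φ P := if h : P.1 ∈ S' then (P.1.trace - c) * φ ⟨P.1, h⟩ else 0
  map_add' φ ψ := by
    funext P
    simp only [Pi.add_apply]
    split_ifs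
    · ring
    · ring
  map_smul' a φ := by
    funext P
    simp only [Pi.smul_apply, smul_eq_mul, RingHom.id_apply]
    split_ifs
    · ring
    · ring

lemma dim_step (t : ℕ) (S0 S' S : Set (Matrix (Fin d) (Fin d) ℝ)) (hS0 : S0 ⊆ S) (hS' : S' ⊆ S)
    (hS : ∀ P ∈ S, P ∈ S0 ∨ P ∈ S') (c : ℝ)
    (h0 : ∀ P ∈ S0, P.trace = c) (h' : ∀ P ∈ S', P.trace ≠ c)
    (hdiv : ∀ f : MvPolynomial (Fin d × Fin d) ℝ, f.totalDegree ≤ t → (∀ P ∈ S0, mev P f = 0) →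
      ∃ g : MvPolynomial (Fin d × Fin d) ℝ, (t = 0 → g = 0) ∧ g.totalDegree ≤ t - 1 ∧
        ∀ P ∈ S', mev P f = (P.trace - c) * mev P g) :
    Module.finrank ℝ (PolOn t S) = Module.finrank ℝ (PolOn t S0) +
      if t = 0 then 0 else Module.finrank ℝ (PolOn (t - 1) S') := by
  obtain ⟨ρ, hρ⟩ : ∃ ρ : (S → ℝ) →ₗ[ℝ] (S0 → ℝ), ∀ φ P, ρ φ P = φ ⟨P.1, hS0 P.2⟩ :=
    ⟨LinearMap.funLeft ℝ ℝ (Set.inclusion hS0), fun φ P => rfl⟩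
  have hmap : (PolOn t S).map ρ = PolOn t S0 := by
    ext φ
    rw [Submodule.mem_map]
    constructor
    · rintro ⟨ψ, hψ, rfl⟩
      obtain ⟨f, hf, hψ⟩ := mem_PolOn.1 hψ
      exact mem_PolOn.2 ⟨f, hf, fun P => by rw [hρ, hψ]⟩
    · intro hφ
      obtain ⟨f, hf, hφ⟩ := mem_PolOn.1 hφ
      refine ⟨fun P => mev P.1 f, mem_PolOn.2 ⟨f, hf, fun P => rfl⟩, ?_⟩
      funext P
      rw [hρ, hφ]
  have hrn := LinearMap.finrank_range_add_finrank_ker (ρ.domRestrict (PolOn t S))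
  rw [LinearMap.range_domRestrict, hmap] at hrn
  rw [← hrn]
  congr 1
  have hker : Module.finrank ℝ (LinearMap.ker (ρ.domRestrict (PolOn t S))) =
      Module.finrank ℝ (PolOn t S ⊓ LinearMap.ker ρ : Submodule ℝ (S → ℝ)) := by
    rw [← Submodule.finrank_map_subtype_eq]
    have : Submodule.map (PolOn t S).subtype (LinearMap.ker (ρ.domRestrict (PolOn t S))) =
        PolOn t S ⊓ LinearMap.ker ρ := by
      rw [← Submodule.map_comap_subtype]
      rfl
    rw [this]
  rw [hker]
  have hmem : ∀ φ : S → ℝ, φ ∈ (PolOn t S ⊓ LinearMap.ker ρ : Submodule ℝ (S → ℝ)) →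
      ∃ g : MvPolynomial (Fin d × Fin d) ℝ, (t = 0 → g = 0) ∧ g.totalDegree ≤ t - 1 ∧
        theta S' S c (fun P => mev P.1 g) = φ := by
    rintro φ ⟨h1, h2⟩
    obtain ⟨f, hf, hφ⟩ := mem_PolOn.1 h1
    have h2' : ∀ P ∈ S0, mev P f = 0 := by
      intro P hP
      have := congrFun (LinearMap.mem_ker.1 h2) ⟨P, hP⟩
      rw [hρ, hφ] at this
      exact this
    obtain ⟨g, hg0, hg1, hg2⟩ := hdiv f hf h2'
    refine ⟨g, hg0, hg1, ?_⟩
    funext P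
    simp only [theta, LinearMap.coe_mk, AddHom.coe_mk]
    split_ifs with h
    · rw [hφ, hg2 P.1 h]
    · rw [hφ, h2' P.1 ((hS P.1 P.2).resolve_right h)]
  split_ifs with ht
  · have : (PolOn t S ⊓ LinearMap.ker ρ : Submodule ℝ (S → ℝ)) = ⊥ := by
      rw [eq_bot_iff]
      intro φ hφ
      obtain ⟨g, hg0, _, hg2⟩ := hmem φ hφ
      rw [hg0 ht] at hg2
      rw [Submodule.mem_bot, ← hg2]
      funext P
      simp [theta]
    rw [this, finrank_bot]
  · have hθ : Function.Injective (theta S' S c) := by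
      intro φ ψ h
      funext P
      have := congrFun h ⟨P.1, hS' P.2⟩
      simp only [theta, LinearMap.coe_mk, AddHom.coe_mk, P.2, dif_pos] at this
      exact mul_left_cancel₀ (sub_ne_zero.2 (h' P.1 P.2)) this
    have : (PolOn t S ⊓ LinearMap.ker ρ : Submodule ℝ (S → ℝ)) =
        (PolOn (t - 1) S').map (theta S' S c) := by
      ext φ
      constructor
      · intro hφ
        obtain ⟨g, _, hg1, hg2⟩ := hmem φ hφ
        exact ⟨_, mem_PolOn.2 ⟨g, hg1, fun P => rfl⟩, hg2⟩
      · rintro ⟨ψ, hψ, rfl⟩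
        obtain ⟨g, hg, hψ⟩ := mem_PolOn.1 hψ
        refine ⟨mem_PolOn.2 ⟨((∑ i, X (i, i)) - C c) * g, ?_, ?_⟩, ?_⟩
        · refine (totalDegree_mul _ _).trans ?_
          have : ((∑ i, X (i, i)) - C c : MvPolynomial (Fin d × Fin d) ℝ).totalDegree ≤ 1 := by
            refine (totalDegree_sub _ _).trans (max_le ?_ (by simp))
            refine (totalDegree_finset_sum _ _).trans (Finset.sup_le fun e _ => ?_)
            simp
          omega
        · intro P
          have e : mev P.1 (((∑ i, X (i, i)) - C c) * g) = (P.1.trace - c) * mev P.1 g := by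
            rw [map_mul, map_sub, map_sum]
            simp only [mev_X]
            simp [mev, Matrix.trace]
          rw [e]
          simp only [theta, LinearMap.coe_mk, AddHom.coe_mk]
          split_ifs with h
          · rw [hψ]
          · rw [h0 P.1 ((hS P.1 P.2).resolve_right h)]; simp
        · rw [SetLike.mem_coe, LinearMap.mem_ker]
          funext P
          rw [hρ]
          simp only [theta, LinearMap.coe_mk, AddHom.coe_mk]
          rw [dif_neg]
          · rfl
          · intro h; exact h' _ h (h0 _ P.2)
    rw [this]
    exact (LinearEquiv.finrank_eq (Submodule.equivMapOfInjective _ hθ _)).symm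

lemma dim_aux (r : ℕ) : ∀ (t : ℕ) (K : ℕ → ℕ), (∀ i < r, ∀ j < r, K i = K j → i = j) →
    (∀ i < r, K i ≤ d) →
    (∀ i j, i ≤ j → j < r → min (K j) (d - K j) ≤ min (K i) (d - K i)) →
    Module.finrank ℝ (PolOn t {P : Matrix (Fin d) (Fin d) ℝ | ∃ i < r, P ∈ Grass d (K i)}) =
      ∑ i ∈ Finset.range (min (t + 1) r), Module.finrank ℝ (PolOn (t - i) (Grass d (K i))) := by
  induction r with
  | zero =>
    intro t K _ _ _
    simp only [Nat.min_zero, Finset.range_zero, Finset.sum_empty]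
    have : IsEmpty {P : Matrix (Fin d) (Fin d) ℝ | ∃ i < 0, P ∈ Grass d (K i)} :=
      ⟨fun P => by obtain ⟨i, hi, _⟩ := P.2; omega⟩
    exact Module.finrank_zero_of_subsingleton
  | succ r ih =>
    intro t K hinj hK hord
    rw [dim_step t (Grass d (K 0)) {P | ∃ i < r, P ∈ Grass d (K (i + 1))} _ ?_ ?_ ?_ (K 0 : ℝ) ?_ ?_ ?_]
    · rcases t with _ | t
      · simp
      · rw [if_neg (by omega), Nat.add_sub_cancel,
          ih t (fun i => K (i + 1)) (fun i hi j hj h => by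
            have := hinj (i + 1) (by omega) (j + 1) (by omega) h; omega)
          (fun i hi => hK _ (by omega)) (fun i j hij hj => hord _ _ (by omega) (by omega))]
        rw [show min (t + 1 + 1) (r + 1) = min (t + 1) r + 1 by omega, Finset.sum_range_succ']
        rw [add_comm, Nat.sub_zero]
        refine congrArg₂ (· + ·) (Finset.sum_congr rfl fun i _ => ?_) rfl
        rw [Nat.add_sub_add_right]
    · intro P hP; exact ⟨0, by omega, hP⟩
    · rintro P ⟨i, hi, hP⟩; exact ⟨i + 1, by omega, hP⟩
    · rintro P ⟨i, hi, hP⟩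
      rcases i with _ | i
      · exact Or.inl hP
      · exact Or.inr ⟨i, by omega, hP⟩
    · intro P hP; exact hP.2.2
    · rintro P ⟨i, hi, hP⟩ h
      rw [hP.2.2] at h
      have := hinj (i + 1) (by omega) 0 (by omega) (by exact_mod_cast h)
      omega
    · intro f hf hv
      obtain ⟨g, hg0, hg1, hg2⟩ := key_div (K 0) (hK 0 (by omega)) t f hf hv
      refine ⟨g, hg0, hg1, ?_⟩
      rintro P ⟨i, hi, hP⟩
      exact hg2 (K (i + 1)) (hK _ (by omega)) (hord 0 (i + 1) (by omega) (by omega)) P hP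

end Dim

/-- Dimension formula for the polynomial space on a union of Grassmannians:
for distinct `k 1, …, k r ∈ {1,…,d−1}` ordered so that `min(k i, d − k i)` is nonincreasing,
and `s = min(t+1, r)`, `dim Pol_t(G_{K,d}) = Σ_{i=1}^s dim Pol_{t−i+1}(G_{k i, d})`. -/
theorem dim_pol_union_eq (d r t : ℕ) (hd : 2 ≤ d) (k : Fin r → ℕ)
    (hinj : Function.Injective k) (hk : ∀ i, 1 ≤ k i ∧ k i ≤ d - 1)
    (hord : ∀ i j : Fin r, i ≤ j → min (k j) (d - k j) ≤ min (k i) (d - k i)) :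
    Module.finrank ℝ (PolOn t (⋃ i, Grass d (k i))) =
      ∑ i : Fin (min (t + 1) r),
        Module.finrank ℝ
          (PolOn (t - (i : ℕ)) (Grass d (k (Fin.castLE (min_le_right (t + 1) r) i)))) := by
  obtain ⟨K, hK⟩ : ∃ K : ℕ → ℕ, ∀ i : Fin r, K i = k i :=
    ⟨fun i => if h : i < r then k ⟨i, h⟩ else 0, fun i => by simp⟩
  have hK' : ∀ (i : ℕ) (h : i < r), K i = k ⟨i, h⟩ := fun i h => hK ⟨i, h⟩
  have h := dim_aux (d := d) r t K
    (fun i hi j hj h => by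
      rw [hK' i hi, hK' j hj] at h
      exact congrArg Fin.val (hinj h))
    (fun i hi => by rw [hK' i hi]; have := (hk ⟨i, hi⟩).2; omega)
    (fun i j hij hj => by
      rw [hK' j hj, hK' i (by omega)]
      exact hord _ _ hij)
  have hS : (⋃ i, Grass d (k i)) =
      {P : Matrix (Fin d) (Fin d) ℝ | ∃ i < r, P ∈ Grass d (K i)} := by
    ext P
    rw [Set.mem_iUnion]
    constructor
    · rintro ⟨i, hi⟩; exact ⟨i, i.2, by rw [hK]; exact hi⟩
    · rintro ⟨i, hi, hP⟩; exact ⟨⟨i, hi⟩, by rw [← hK]; exact hP⟩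
  rw [hS, h, ← Fin.sum_univ_eq_sum_range
    (fun i => Module.finrank ℝ (PolOn (t - i) (Grass d (K i))))]
  refine Finset.sum_congr rfl fun i _ => ?_
  rw [← hK]
  rfl
end
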